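/- Let C be an algebra of global dimension 2, B = C ⋉ Ext^2_C(DC,C), P a projective C-module, and P̄ a projective cover in mod C of τ_C^{-1}Ω_C^{-1}P. Then P is τ_B-rigid if and only if Hom_C(P̄, P) = 0. -/

import Mathlib

open CategoryTheory MulOpposite

open CategoryTheory MulOpposite

/-! Core definitions: right `A`-modules are modules over `Aᵐᵒᵖ`. -/

/-- The category of (small) modules over a ring `R`.  For a `k`-algebra `A`,
right `A`-modules are `Mdl Aᵐᵒᵖ`. -/
abbrev Mdl (R : Type) [Ring R] := ModuleCat.{0} R

section Generic

variable (R : Type) [Ring R]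

/-- `f : P → M` is a projective cover: `P` projective, `f` surjective with
superfluous kernel. -/
def IsProjCover {P M : Mdl R} (f : P →ₗ[R] M) : Prop :=
  Module.Projective R P ∧ Function.Surjective f ∧
    ∀ N : Submodule R P, N ⊔ LinearMap.ker f = ⊤ → N = ⊤

/-- `f : M → I` is an injective envelope: `I` injective, `f` injective with
essential image. -/
def IsInjEnv {M I : Mdl R} (f : M →ₗ[R] I) : Prop :=
  Module.Injective R I ∧ Function.Injective f ∧
    ∀ K : Submodule R I, K ⊓ LinearMap.range f = ⊥ → K = ⊥

/-- `Hom_R(X, Y) = 0`. -/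
def HomZero (X Y : Mdl R) : Prop := ∀ f : X →ₗ[R] Y, f = 0

/-- `X ∈ Gen M`: `X` is an epimorphic image of a finite direct sum of copies of `M`. -/
def MemGen (M X : Mdl R) : Prop :=
  ∃ (d : ℕ) (f : (Fin d → M) →ₗ[R] X), Function.Surjective f

/-- `X ∈ add M`: `X` is a direct summand of a finite direct sum of copies of `M`. -/
def MemAdd (M X : Mdl R) : Prop :=
  ∃ (n : ℕ) (s : X →ₗ[R] (Fin n → M)) (r : (Fin n → M) →ₗ[R] X),
    r.comp s = LinearMap.id

/-- projective dimension at most 1: a length-one projective resolution exists. -/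
def PdLE1 (M : Mdl R) : Prop :=
  ∃ (P1 P0 : Mdl R) (d1 : P1 →ₗ[R] P0) (d0 : P0 →ₗ[R] M),
    Module.Projective R P1 ∧ Module.Projective R P0 ∧
    Function.Injective d1 ∧ Function.Surjective d0 ∧
    LinearMap.range d1 = LinearMap.ker d0

/-- projective dimension at most 2. -/
def PdLE2 (M : Mdl R) : Prop :=
  ∃ (P2 P1 P0 : Mdl R) (d2 : P2 →ₗ[R] P1) (d1 : P1 →ₗ[R] P0) (d0 : P0 →ₗ[R] M),
    Module.Projective R P2 ∧ Module.Projective R P1 ∧ Module.Projective R P0 ∧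
    Function.Injective d2 ∧ Function.Surjective d0 ∧
    LinearMap.range d2 = LinearMap.ker d1 ∧ LinearMap.range d1 = LinearMap.ker d0

/-- injective dimension at most 1. -/
def IdLE1 (M : Mdl R) : Prop :=
  ∃ (I0 I1 : Mdl R) (d0 : M →ₗ[R] I0) (d1 : I0 →ₗ[R] I1),
    Module.Injective R I0 ∧ Module.Injective R I1 ∧
    Function.Injective d0 ∧ Function.Surjective d1 ∧
    LinearMap.range d0 = LinearMap.ker d1

/-- global dimension at most 2 (every module has projective dimension ≤ 2). -/
def GlDimLE2 : Prop := ∀ M : Mdl R, PdLE2 R M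

/-- global dimension exactly 2. -/
def GlDimEq2 : Prop := GlDimLE2 R ∧ ¬ ∀ M : Mdl R, PdLE1 R M

/-- `W` is a first syzygy `Ω M` of `M` (kernel of a projective cover). -/
def IsSyzygy (M W : Mdl R) : Prop :=
  ∃ (P : Mdl R) (f : P →ₗ[R] M), IsProjCover R f ∧
    Nonempty (W ≃ₗ[R] LinearMap.ker f)

/-- `W` is a first cosyzygy `Ω⁻¹ M` of `M` (cokernel of an injective envelope). -/
def IsCosyzygy (M W : Mdl R) : Prop :=
  ∃ (I : Mdl R) (f : M →ₗ[R] I), IsInjEnv R f ∧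
    Nonempty (W ≃ₗ[R] (I ⧸ LinearMap.range f))

/-- `P1 --d1--> P0 --d0--> M → 0` is a minimal projective presentation. -/
def IsMinPres {P1 P0 M : Mdl R} (d1 : P1 →ₗ[R] P0) (d0 : P0 →ₗ[R] M) : Prop :=
  IsProjCover R d0 ∧ Module.Projective R P1 ∧
  LinearMap.range d1 = LinearMap.ker d0 ∧
  ∀ N : Submodule R P1, N ⊔ LinearMap.ker d1 = ⊤ → N = ⊤

/-- `Ext¹_R(X, Y) = 0`, expressed as: every short exact sequence
`0 → Y → Z → X → 0` splits. -/
def Ext1Zero (X Y : Mdl R) : Prop :=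
  ∀ (Z : Mdl R) (i : Y →ₗ[R] Z) (p : Z →ₗ[R] X),
    Function.Injective i → Function.Surjective p →
    LinearMap.range i = LinearMap.ker p →
    ∃ s : X →ₗ[R] Z, p.comp s = LinearMap.id

/-- partial tilting module: `pd ≤ 1` and `Ext¹(M,M) = 0`. -/
def PartialTilting (M : Mdl R) : Prop := PdLE1 R M ∧ Ext1Zero R M M

/-- tilting module: partial tilting plus a coresolution
`0 → R → T' → T'' → 0` with `T', T'' ∈ add M` of the regular module. -/
def IsTilting (M : Mdl R) : Prop :=
  PartialTilting R M ∧
  ∃ (T' T'' : Mdl R) (i : ModuleCat.of R R →ₗ[R] T') (p : T' →ₗ[R] T''),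
    MemAdd R M T' ∧ MemAdd R M T'' ∧
    Function.Injective i ∧ Function.Surjective p ∧
    LinearMap.range i = LinearMap.ker p

/-- an indecomposable (nonzero) module. -/
def Indecomp (M : Mdl R) : Prop :=
  Nontrivial M ∧ ∀ (U V : Submodule R M), IsCompl U V → U = ⊥ ∨ V = ⊥

/-- the number of isomorphism classes of simple `R`-modules is `n`. -/
def SimpleCount (n : ℕ) : Prop :=
  ∃ S : Fin n → Mdl R,
    (∀ i, IsSimpleModule R (S i)) ∧
    (∀ i j, Nonempty ((S i) ≃ₗ[R] (S j)) → i = j) ∧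
    ∀ X : Mdl R, IsSimpleModule R X → ∃ i, Nonempty (X ≃ₗ[R] S i)

end Generic

section Duality

variable (k : Type) [Field k] (A : Type) [Ring A] [Algebra k A]

/-- `N` (a right `A`-module) is the `k`-linear dual `D M` of the left `A`-module `M`:
witnessed by a nondegenerate balanced `k`-bilinear pairing. -/
def IskDual (N : Mdl Aᵐᵒᵖ) (M : Mdl A) : Prop :=
  ∃ φ : N → M → k,
    (∀ n n' m, φ (n + n') m = φ n m + φ n' m) ∧
    (∀ n m m', φ n (m + m') = φ n m + φ n m') ∧
    (∀ (c : k) n m, φ n ((algebraMap k A c) • m) = c * φ n m) ∧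
    (∀ (a : A) n m, φ (op a • n) m = φ n (a • m)) ∧
    (∀ n, (∀ m, φ n m = 0) → n = 0) ∧
    (∀ m, (∀ n, φ n m = 0) → m = 0)

/-- `T = τ M`: the Auslander–Reiten translate of the right `A`-module `M`,
i.e. the `k`-dual of the transpose `Tr M` computed from a minimal projective
presentation. -/
def IsTau (M T : Mdl Aᵐᵒᵖ) : Prop :=
  ∃ (P1 P0 : Mdl Aᵐᵒᵖ) (d1 : P1 →ₗ[Aᵐᵒᵖ] P0) (d0 : P0 →ₗ[Aᵐᵒᵖ] M),
    IsMinPres Aᵐᵒᵖ d1 d0 ∧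
    ∃ (Tr : Mdl A) (q : (P1 →ₗ[Aᵐᵒᵖ] A) →ₗ[A] Tr),
      Function.Surjective q ∧
      (∀ g : P1 →ₗ[Aᵐᵒᵖ] A, q g = 0 ↔ ∃ f : P0 →ₗ[Aᵐᵒᵖ] A, g = f.comp d1) ∧
      IskDual k A T Tr

/-- `T = τ⁻¹ M`: the inverse Auslander–Reiten translate, `Tr (D M)`, computed
from a minimal projective presentation of the left module `D M`. -/
def IsTauInv (M T : Mdl Aᵐᵒᵖ) : Prop :=
  ∃ (DM : Mdl A), IskDual k A M DM ∧
  ∃ (Q1 Q0 : Mdl A) (d1 : Q1 →ₗ[A] Q0) (d0 : Q0 →ₗ[A] DM),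
    IsMinPres A d1 d0 ∧
    ∃ q : (Q1 →ₗ[A] A) →ₗ[Aᵐᵒᵖ] T,
      Function.Surjective q ∧
      ∀ g : Q1 →ₗ[A] A, q g = 0 ↔ ∃ f : Q0 →ₗ[A] A, g = f.comp d1

/-- `W = τ⁻¹ Ω⁻¹ M`. -/
def IsTauInvCosyz (M W : Mdl Aᵐᵒᵖ) : Prop :=
  ∃ V, IsCosyzygy Aᵐᵒᵖ M V ∧ IsTauInv k A V W

/-- `W = τ Ω M`. -/
def IsTauSyz (M W : Mdl Aᵐᵒᵖ) : Prop :=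
  ∃ V, IsSyzygy Aᵐᵒᵖ M V ∧ IsTau k A V W

/-- `M` is `τ`-rigid: `Hom(M, τM) = 0`. -/
def TauRigid (M : Mdl Aᵐᵒᵖ) : Prop :=
  ∀ T, IsTau k A M T → HomZero Aᵐᵒᵖ M T

/-- `M` is `τ`-tilting: `τ`-rigid with as many pairwise nonisomorphic
indecomposable summands as there are simple modules. -/
def TauTilting (M : Mdl Aᵐᵒᵖ) : Prop :=
  TauRigid k A M ∧
  ∃ (n : ℕ) (N : Fin n → Mdl Aᵐᵒᵖ),
    (∀ i, Indecomp Aᵐᵒᵖ (N i)) ∧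
    (∀ i j, Nonempty ((N i) ≃ₗ[Aᵐᵒᵖ] (N j)) → i = j) ∧
    Nonempty (M ≃ₗ[Aᵐᵒᵖ] ((i : Fin n) → N i)) ∧
    SimpleCount Aᵐᵒᵖ n

end Duality


section SplitExt

variable {B C : Type} [Ring B] [Ring C]

/-- a right `C`-module viewed as a right `B`-module via a ring hom `π : B → C`. -/
def modAlong (π : B →+* C) (M : Mdl Cᵐᵒᵖ) : Mdl Bᵐᵒᵖ :=
  letI : Module Bᵐᵒᵖ M := Module.compHom M (RingHom.op π)
  ModuleCat.of _ M

/-- `X` is the induced module `M ⊗_C B` along `σ : C → B`, characterized by the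
universal property of induction (extension of scalars). -/
def IsInducedAlong (σ : C →+* B) (M : Mdl Cᵐᵒᵖ) (X : Mdl Bᵐᵒᵖ) : Prop :=
  ∃ φ : M →+ X,
    (∀ (c : C) (m : M), φ (op c • m) = op (σ c) • φ m) ∧
    ∀ (Y : Mdl Bᵐᵒᵖ) (ψ : M →+ Y),
      (∀ (c : C) (m : M), ψ (op c • m) = op (σ c) • ψ m) →
      ∃! h : X →ₗ[Bᵐᵒᵖ] Y, ∀ m, h (φ m) = ψ m

/-- `X` is the coinduced module `D(B ⊗_C D M) ≅ Hom_C(B, M)` along `σ : C → B`,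
characterized by the universal property of coinduction. -/
def IsCoinducedAlong (σ : C →+* B) (M : Mdl Cᵐᵒᵖ) (X : Mdl Bᵐᵒᵖ) : Prop :=
  ∃ p : X →+ M,
    (∀ (c : C) (x : X), p (op (σ c) • x) = op c • p x) ∧
    ∀ (Y : Mdl Bᵐᵒᵖ) (ψ : Y →+ M),
      (∀ (c : C) (y : Y), ψ (op (σ c) • y) = op c • ψ y) →
      ∃! h : Y →ₗ[Bᵐᵒᵖ] X, ∀ y, p (h y) = ψ y

end SplitExt

section TrivExt

variable (C : Type) [Ring C] (E : Type) [AddCommGroup E]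
  [Module C E] [Module Cᵐᵒᵖ E] [SMulCommClass C Cᵐᵒᵖ E]

/-- the projection `B = C ⋉ E → C` as a ring hom. -/
def tszeFst : TrivSqZeroExt C E →+* C where
  toFun := TrivSqZeroExt.fst
  map_one' := rfl
  map_mul' _ _ := rfl
  map_zero' := rfl
  map_add' _ _ := rfl

/-- the inclusion `σ : C → B = C ⋉ E` as a ring hom. -/
def tszeInl : C →+* TrivSqZeroExt C E where
  toFun := TrivSqZeroExt.inl
  map_one' := rfl
  map_mul' x y := TrivSqZeroExt.inl_mul (M := E) x y
  map_zero' := TrivSqZeroExt.inl_zero (M := E)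
  map_add' x y := TrivSqZeroExt.inl_add (M := E) x y

/-- a right `C`-module viewed as a module over the trivial extension `C ⋉ E`. -/
def modB (M : Mdl Cᵐᵒᵖ) : Mdl (TrivSqZeroExt C E)ᵐᵒᵖ :=
  modAlong (tszeFst C E) M

/-- `X = M ⊗_C B` for `B = C ⋉ E`. -/
def IsInduced (M : Mdl Cᵐᵒᵖ) (X : Mdl (TrivSqZeroExt C E)ᵐᵒᵖ) : Prop :=
  IsInducedAlong (tszeInl C E) M X

/-- `X = D(B ⊗_C D M)` for `B = C ⋉ E`. -/
def IsCoinduced (M : Mdl Cᵐᵒᵖ) (X : Mdl (TrivSqZeroExt C E)ᵐᵒᵖ) : Prop :=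
  IsCoinducedAlong (tszeInl C E) M X

end TrivExt

section RelExt

variable (k : Type) [Field k] (C : Type) [Ring C] [Algebra k C]
  (E : Type) [AddCommGroup E] [Module C E] [Module Cᵐᵒᵖ E]

/-- The `C`-`C`-bimodule `E` is `Ext²_C(DC, C)`: there is a projective
resolution `0 → P2 → P1 → P0 → DC → 0` of the right module `DC = Hom_k(C,k)`
(characterized by a nondegenerate balanced pairing `φ` with `C`), and `E` is
the cokernel of `Hom_C(P1, C) → Hom_C(P2, C)` as a left `C`-module, with the
right `C`-action on `E` induced (contravariantly, via lifts of the left action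
on `DC`) by functoriality of `Ext²(-, C)`. -/
def IsRelExt : Prop :=
  ∃ (DC : Mdl Cᵐᵒᵖ) (φ : DC → C → k),
    (∀ n n' m, φ (n + n') m = φ n m + φ n' m) ∧
    (∀ n m m', φ n (m + m') = φ n m + φ n m') ∧
    (∀ (c : k) n m, φ n ((algebraMap k C c) * m) = c * φ n m) ∧
    (∀ (a : C) n m, φ (op a • n) m = φ n (a * m)) ∧
    (∀ n, (∀ m, φ n m = 0) → n = 0) ∧
    (∀ m, (∀ n, φ n m = 0) → m = 0) ∧
    ∃ (P2 P1 P0 : Mdl Cᵐᵒᵖ) (d2 : P2 →ₗ[Cᵐᵒᵖ] P1) (d1 : P1 →ₗ[Cᵐᵒᵖ] P0)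
      (d0 : P0 →ₗ[Cᵐᵒᵖ] DC),
      Module.Projective Cᵐᵒᵖ P2 ∧ Module.Projective Cᵐᵒᵖ P1 ∧
      Module.Projective Cᵐᵒᵖ P0 ∧
      Function.Injective d2 ∧ Function.Surjective d0 ∧
      LinearMap.range d2 = LinearMap.ker d1 ∧
      LinearMap.range d1 = LinearMap.ker d0 ∧
      ∃ q : (P2 →ₗ[Cᵐᵒᵖ] C) →ₗ[C] E,
        Function.Surjective q ∧
        (∀ g : P2 →ₗ[Cᵐᵒᵖ] C, q g = 0 ↔ ∃ f : P1 →ₗ[Cᵐᵒᵖ] C, g = f.comp d2) ∧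
        ∀ c : C, ∃ (μ : DC →ₗ[Cᵐᵒᵖ] DC) (f0 : P0 →ₗ[Cᵐᵒᵖ] P0)
            (f1 : P1 →ₗ[Cᵐᵒᵖ] P1) (f2 : P2 →ₗ[Cᵐᵒᵖ] P2),
          (∀ n x, φ (μ n) x = φ n (x * c)) ∧
          d0.comp f0 = μ.comp d0 ∧
          d1.comp f1 = f0.comp d1 ∧
          d2.comp f2 = f1.comp d2 ∧
          ∀ g : P2 →ₗ[Cᵐᵒᵖ] C, q (g.comp f2) = op c • q g

end RelExt



section GenericLemmas

variable {R : Type} [Ring R]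

theorem lift_exact {A X Y : Type} [AddCommGroup A] [AddCommGroup X] [AddCommGroup Y]
    [Module R A] [Module R X] [Module R Y] (hA : Module.Projective R A)
    (h : A →ₗ[R] Y) (d : X →ₗ[R] Y) (hr : ∀ a, h a ∈ LinearMap.range d) :
    ∃ l : A →ₗ[R] X, ∀ a, d (l a) = h a := by
  obtain ⟨l, hl⟩ := Module.projective_lifting_property d.rangeRestrict
    (h.codRestrict _ hr) d.surjective_rangeRestrict
  refine ⟨l, fun a => ?_⟩
  have := congrArg Subtype.val (LinearMap.congr_fun hl a)
  simpa using this

theorem ext_exact {X' X J : Type} [AddCommGroup X'] [AddCommGroup X] [AddCommGroup J]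
    [Module R X'] [Module R X] [Module R J] (hJ : Module.Injective R J)
    (d : X' →ₗ[R] X) (h : X' →ₗ[R] J) (hk : ∀ x, d x = 0 → h x = 0) :
    ∃ l : X →ₗ[R] J, ∀ x, l (d x) = h x := by
  have hk' : LinearMap.ker d ≤ LinearMap.ker h := fun x hx => by
    simpa using hk x (by simpa using hx)
  obtain ⟨l, hl⟩ := hJ.out ((LinearMap.ker d).liftQ d le_rfl)
    (by rw [← LinearMap.ker_eq_bot]; exact Submodule.ker_liftQ_eq_bot _ _ _ le_rfl)
    ((LinearMap.ker d).liftQ h hk')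
  refine ⟨l, fun x => ?_⟩
  simpa using hl ((LinearMap.ker d).mkQ x)

/-- a cover detects homs into subquotients. -/
theorem cover_to_quot {Q X Y : Type} [AddCommGroup Q] [AddCommGroup X] [AddCommGroup Y]
    [Module R Q] [Module R X] [Module R Y] (p : Q →ₗ[R] X) (hp : Function.Surjective p)
    (hs : ∀ N : Submodule R Q, N ⊔ LinearMap.ker p = ⊤ → N = ⊤)
    (u : Q →ₗ[R] Y) (hu : u ≠ 0) :
    ∃ h : X →ₗ[R] (Y ⧸ (LinearMap.ker p).map u), h ≠ 0 := by
  obtain ⟨e, he⟩ : ∃ e : (Q ⧸ LinearMap.ker p) ≃ₗ[R] X, ∀ x, e ((LinearMap.ker p).mkQ x) = p x :=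
    ⟨p.quotKerEquivOfSurjective hp, fun x => by simp⟩
  refine ⟨((LinearMap.ker p).mapQ ((LinearMap.ker p).map u) u
    (Submodule.le_comap_map _ _)).comp e.symm.toLinearMap, fun h0 => hu ?_⟩
  have h1 : ∀ x, u x ∈ (LinearMap.ker p).map u := by
    intro x
    have := LinearMap.congr_fun h0 (p x)
    rw [← he x] at this
    simpa using this
  have h2 : LinearMap.ker u = ⊤ := by
    apply hs
    rw [eq_top_iff]
    intro x _
    obtain ⟨y, hy, hyx⟩ := h1 x
    have : x = (x - y) + y := by abel
    rw [this]
    exact Submodule.add_mem_sup (by simp [hyx]) hy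
  exact LinearMap.ker_eq_top.1 h2

theorem quot_to_cover {Q X Y : Type} [AddCommGroup Q] [AddCommGroup X] [AddCommGroup Y]
    [Module R Q] [Module R X] [Module R Y] (hQ : Module.Projective R Q)
    (p : Q →ₗ[R] X) (hp : Function.Surjective p)
    {Z : Type} [AddCommGroup Z] [Module R Z] (π : Y →ₗ[R] Z) (hπ : Function.Surjective π)
    (h : X →ₗ[R] Z) (hh : h ≠ 0) : ∃ u : Q →ₗ[R] Y, u ≠ 0 := by
  obtain ⟨u, hu⟩ := Module.projective_lifting_property π (h.comp p) hπ
  refine ⟨u, fun h0 => hh ?_⟩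
  ext x
  obtain ⟨y, rfl⟩ := hp x
  have := LinearMap.congr_fun hu y
  simpa [h0] using this.symm

/-- superfluous kernel and finite target imply finite. -/
theorem finite_of_cover {Q X : Type} [AddCommGroup Q] [AddCommGroup X]
    [Module R Q] [Module R X] (p : Q →ₗ[R] X) (hp : Function.Surjective p)
    (hs : ∀ N : Submodule R Q, N ⊔ LinearMap.ker p = ⊤ → N = ⊤)
    [Module.Finite R X] : Module.Finite R Q := by
  obtain ⟨n, f, hf⟩ := Module.Finite.exists_fin' R X
  obtain ⟨l, hl⟩ := Module.projective_lifting_property p f hp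
  refine Module.Finite.of_surjective l (LinearMap.range_eq_top.1 (hs _ ?_))
  rw [eq_top_iff]
  intro x _
  obtain ⟨y, hy⟩ := hf (p x)
  have hly : p (l y) = p x := by rw [← hy]; exact LinearMap.congr_fun hl y
  have : x = l y + (x - l y) := by abel
  rw [this]
  exact Submodule.add_mem_sup (LinearMap.mem_range_self _ _) (by simp [hly])

/-- existence of projective covers over artinian rings. -/
theorem exists_projCover [IsArtinianRing R] [IsNoetherianRing R] (M : Mdl R)
    [Module.Finite R M] : ∃ (Q : Mdl R) (f : Q →ₗ[R] M), IsProjCover R f := by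
  obtain ⟨n, f, hf⟩ := Module.Finite.exists_fin' R M
  obtain ⟨N, ⟨hN1, hN2⟩, hmin⟩ := IsArtinian.set_has_minimal
    {N : Submodule R (Fin n → R) | Module.Projective R N ∧ Function.Surjective (f.domRestrict N)}
    ⟨⊤, Module.Projective.of_equiv (Submodule.topEquiv).symm, fun m => by
      obtain ⟨x, hx⟩ := hf m
      exact ⟨⟨x, trivial⟩, hx⟩⟩
  refine ⟨ModuleCat.of R N, f.domRestrict N, hN1, hN2, fun L hL => ?_⟩
  change Submodule R N at L
  have hLs : Function.Surjective ((f.domRestrict N).comp L.subtype) := by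
    intro m
    obtain ⟨x, hx⟩ := hN2 m
    have hx' : x ∈ L ⊔ LinearMap.ker (f.domRestrict N) := by
      have : L ⊔ LinearMap.ker (f.domRestrict N) = ⊤ := hL
      rw [this]; trivial
    obtain ⟨y, hy, z, hz, rfl⟩ := Submodule.mem_sup.1 hx'
    refine ⟨⟨y, hy⟩, ?_⟩
    rw [← hx, map_add, LinearMap.mem_ker.1 hz, add_zero]; rfl
  obtain ⟨l, hl⟩ := Module.projective_lifting_property _ (f.domRestrict N) hLs
  set h : Module.End R N := L.subtype.comp l with hh
  have hfh : ∀ x, f.domRestrict N (h x) = f.domRestrict N x := fun x => LinearMap.congr_fun hl x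
  have hfhn : ∀ (m : ℕ) x, f.domRestrict N ((h ^ m) x) = f.domRestrict N x := by
    intro m
    induction m with
    | zero => intro x; rfl
    | succ m ih => intro x; rw [pow_succ', Module.End.mul_apply, hfh, ih]
  obtain ⟨m, hm⟩ := Filter.eventually_atTop.1 (LinearMap.eventually_isCompl_ker_pow_range_pow h)
  have hc := hm (m + 1) (by omega)
  have hproj : Module.Projective R (LinearMap.range (h ^ (m + 1))) := by
    refine Module.Projective.of_split (LinearMap.range (h ^ (m + 1))).subtype
      (Submodule.projectionOnto _ _ hc.symm) ?_
    refine LinearMap.ext fun x => ?_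
    exact Submodule.projectionOnto_apply_left hc.symm x
  have hN' : ¬ ((LinearMap.range (h ^ (m + 1))).map N.subtype < N) := by
    apply hmin
    refine ⟨Module.Projective.of_equiv
      (Submodule.equivMapOfInjective N.subtype N.injective_subtype _), fun y => ?_⟩
    obtain ⟨x, hx⟩ := hN2 y
    exact ⟨⟨((h ^ (m + 1)) x : N), ⟨_, LinearMap.mem_range_self _ _, rfl⟩⟩, by
      rw [← hx, ← hfhn (m + 1) x]; rfl⟩
  have hle : (LinearMap.range (h ^ (m + 1))).map N.subtype ≤ N := Submodule.map_subtype_le _ _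
  have heq : (LinearMap.range (h ^ (m + 1))).map N.subtype = N := by
    by_contra hne
    exact hN' (lt_of_le_of_ne hle hne)
  change L = ⊤
  rw [eq_top_iff]
  intro x _
  have hx : (x : Fin n → R) ∈ (LinearMap.range (h ^ (m + 1))).map N.subtype := by
    rw [heq]; exact x.2
  obtain ⟨y, ⟨z, rfl⟩, hyx⟩ := hx
  have : (h ^ (m + 1)) z = x := Subtype.ext hyx
  rw [← this, pow_succ', Module.End.mul_apply]
  exact (l _).2

/-- finite dual basis. -/
theorem exists_dual_basis (Q : Type) [AddCommGroup Q] [Module R Q] (hQ : Module.Projective R Q)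
    [Module.Finite R Q] : ∃ (n : ℕ) (x : Fin n → Q) (f : Fin n → (Q →ₗ[R] R)),
      ∀ y, y = ∑ i, f i y • x i := by
  obtain ⟨n, p, hp⟩ := Module.Finite.exists_fin' R Q
  obtain ⟨s, hs⟩ := Module.projective_lifting_property p LinearMap.id hp
  refine ⟨n, fun i => p (Pi.single i 1), fun i => (LinearMap.proj i).comp s, fun y => ?_⟩
  have h1 : p (s y) = y := LinearMap.congr_fun hs y
  conv_lhs => rw [← h1, pi_eq_sum_univ' (s y), map_sum]
  simp

end GenericLemmas


section Balance

variable {R : Type} [Ring R]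
  {P2 P1 P0 D P I0 J0 J1 : Type}
  [AddCommGroup P2] [AddCommGroup P1] [AddCommGroup P0] [AddCommGroup D]
  [AddCommGroup P] [AddCommGroup I0] [AddCommGroup J0] [AddCommGroup J1]
  [Module R P2] [Module R P1] [Module R P0] [Module R D]
  [Module R P] [Module R I0] [Module R J0] [Module R J1]

/-- zigzag relation between `Hom(P2,P)` and `Hom(D,J1)`. -/
def ZRel (d2 : P2 →ₗ[R] P1) (d1 : P1 →ₗ[R] P0) (d0 : P0 →ₗ[R] D)
    (i : P →ₗ[R] I0) (a : I0 →ₗ[R] J0) (b : J0 →ₗ[R] J1)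
    (u : P2 →ₗ[R] P) (w : D →ₗ[R] J1) : Prop :=
  ∃ (v1 : P1 →ₗ[R] I0) (v0 : P0 →ₗ[R] J0),
    (∀ x, v1 (d2 x) = i (u x)) ∧ (∀ x, v0 (d1 x) = a (v1 x)) ∧ (∀ x, w (d0 x) = b (v0 x))

theorem balance (d2 : P2 →ₗ[R] P1) (d1 : P1 →ₗ[R] P0) (d0 : P0 →ₗ[R] D)
    (i : P →ₗ[R] I0) (a : I0 →ₗ[R] J0) (b : J0 →ₗ[R] J1)
    (hP2 : Module.Projective R P2) (hP1 : Module.Projective R P1) (hP0 : Module.Projective R P0)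
    (hI0 : Module.Injective R I0) (hJ0 : Module.Injective R J0)
    (hd2 : Function.Injective d2) (hd0 : Function.Surjective d0)
    (e1 : LinearMap.range d2 = LinearMap.ker d1) (e0 : LinearMap.range d1 = LinearMap.ker d0)
    (hi : Function.Injective i) (hb : Function.Surjective b)
    (c0 : LinearMap.range i = LinearMap.ker a) (c1 : LinearMap.range a = LinearMap.ker b)
    {W : Type} [AddCommGroup W] (ρ : (D →ₗ[R] J1) →+ W) (hρ : Function.Surjective ρ)
    (hρk : ∀ w, ρ w = 0 ↔ ∃ l : D →ₗ[R] J0, w = b.comp l) :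
    ∃ Φ : (P2 →ₗ[R] P) →+ W, Function.Surjective Φ ∧
      (∀ u, Φ u = 0 ↔ ∃ f : P1 →ₗ[R] P, u = f.comp d2) ∧
      (∀ u w, ZRel d2 d1 d0 i a b u w → Φ u = ρ w) ∧
      ∀ u, ∃ w, ZRel d2 d1 d0 i a b u w := by
  have z1 : ∀ x, d1 (d2 x) = 0 := fun x => by
    have : d2 x ∈ LinearMap.ker d1 := e1 ▸ LinearMap.mem_range_self _ _
    simpa using this
  have z0 : ∀ x, d0 (d1 x) = 0 := fun x => by
    have : d1 x ∈ LinearMap.ker d0 := e0 ▸ LinearMap.mem_range_self _ _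
    simpa using this
  have y1 : ∀ x, a (i x) = 0 := fun x => by
    have : i x ∈ LinearMap.ker a := c0 ▸ LinearMap.mem_range_self _ _
    simpa using this
  have y0 : ∀ x, b (a x) = 0 := fun x => by
    have : a x ∈ LinearMap.ker b := c1 ▸ LinearMap.mem_range_self _ _
    simpa using this
  have x1 : ∀ x, d1 x = 0 → ∃ y, d2 y = x := fun x hx => by
    have : x ∈ LinearMap.range d2 := by rw [e1]; simpa using hx
    exact this
  have x0 : ∀ x, d0 x = 0 → ∃ y, d1 y = x := fun x hx => by
    have : x ∈ LinearMap.range d1 := by rw [e0]; simpa using hx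
    exact this
  have tot1 : ∀ u, ∃ w, ZRel d2 d1 d0 i a b u w := by
    intro u
    obtain ⟨v1, h1⟩ := ext_exact hI0 d2 (i.comp u) (fun x hx => by
      have : x = 0 := hd2 (by simpa using hx)
      simp [this])
    obtain ⟨v0, h0⟩ := ext_exact hJ0 d1 (a.comp v1) (fun x hx => by
      obtain ⟨y, rfl⟩ := x1 x hx
      simp [h1, y1])
    have : ∀ x ∈ LinearMap.ker d0, b (v0 x) = 0 := fun x hx => by
      obtain ⟨y, rfl⟩ := x0 x hx
      simp [h0, y0]
    let e := d0.quotKerEquivOfSurjective hd0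
    refine ⟨((LinearMap.ker d0).liftQ (b.comp v0) this).comp e.symm.toLinearMap, v1, v0, h1, h0,
      fun x => ?_⟩
    have : e.symm (d0 x) = (LinearMap.ker d0).mkQ x := by
      rw [LinearEquiv.symm_apply_eq]; simp [e]
    simp [this]
    rfl
  have tot2 : ∀ w, ∃ u, ZRel d2 d1 d0 i a b u w := by
    intro w
    obtain ⟨v0, h0⟩ := lift_exact hP0 (w.comp d0) b (fun x => hb _)
    obtain ⟨v1, h1⟩ := lift_exact hP1 (v0.comp d1) a (fun x => by
      rw [c1]; simp [h0, z0])
    obtain ⟨u, hu⟩ := lift_exact hP2 (v1.comp d2) i (fun x => by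
      rw [c0]; simp [h1, z1])
    exact ⟨u, v1, v0, fun x => (hu x).symm, fun x => (h1 x).symm, fun x => (h0 x).symm⟩
  have add : ∀ u u' w w', ZRel d2 d1 d0 i a b u w → ZRel d2 d1 d0 i a b u' w' →
      ZRel d2 d1 d0 i a b (u - u') (w - w') := by
    rintro u u' w w' ⟨v1, v0, h1, h2, h3⟩ ⟨v1', v0', h1', h2', h3'⟩
    exact ⟨v1 - v1', v0 - v0', fun x => by simp [h1, h1'], fun x => by simp [h2, h2'],
      fun x => by simp [h3, h3']⟩
  have add' : ∀ u u' w w', ZRel d2 d1 d0 i a b u w → ZRel d2 d1 d0 i a b u' w' →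
      ZRel d2 d1 d0 i a b (u + u') (w + w') := by
    rintro u u' w w' ⟨v1, v0, h1, h2, h3⟩ ⟨v1', v0', h1', h2', h3'⟩
    exact ⟨v1 + v1', v0 + v0', fun x => by simp [h1, h1'], fun x => by simp [h2, h2'],
      fun x => by simp [h3, h3']⟩
  have ker : ∀ u w, ZRel d2 d1 d0 i a b u w →
      ((∃ f : P1 →ₗ[R] P, u = f.comp d2) ↔ ∃ l : D →ₗ[R] J0, w = b.comp l) := by
    rintro u w ⟨v1, v0, h1, h2, h3⟩
    constructor
    · rintro ⟨f, rfl⟩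
      obtain ⟨h, hh⟩ := ext_exact hI0 d1 (v1 - i.comp f) (fun x hx => by
        obtain ⟨y, rfl⟩ := x1 x hx
        simp [h1])
      have : ∀ x ∈ LinearMap.ker d0, (v0 - a.comp h) x = 0 := fun x hx => by
        obtain ⟨y, rfl⟩ := x0 x hx
        simp [h2, hh, y1]
      obtain ⟨l, hl⟩ := ext_exact hJ0 d0 (v0 - a.comp h) this
      refine ⟨l, ?_⟩
      ext n
      obtain ⟨x, rfl⟩ := hd0 n
      simp [hl, h3, y0]
    · rintro ⟨l, rfl⟩
      obtain ⟨h, hh⟩ := lift_exact hP0 (v0 - l.comp d0) a (fun x => by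
        rw [c1]; simpa [sub_eq_zero] using (h3 x).symm)
      obtain ⟨f, hf⟩ := lift_exact hP1 (v1 - h.comp d1) i (fun x => by
        rw [c0]; simp [hh, h2, z0])
      refine ⟨f, ?_⟩
      ext x
      apply hi
      simp [hf, z1, h1]
  choose F hF using tot1
  have uniq : ∀ u w, ZRel d2 d1 d0 i a b u w → ρ (F u) = ρ w := by
    intro u w h
    have h1 := add _ _ _ _ (hF u) h
    have h2 := (ker _ _ h1).1 ⟨0, by simp⟩
    have h3 := (hρk _).2 h2
    rw [map_sub] at h3
    exact sub_eq_zero.1 h3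
  refine ⟨AddMonoidHom.mk' (fun u => ρ (F u)) (fun u u' => ?_), ?_, ?_, uniq, fun u => ⟨_, hF u⟩⟩
  · rw [uniq _ _ (add' _ _ _ _ (hF u) (hF u')), map_add]
  · intro y
    obtain ⟨w, rfl⟩ := hρ y
    obtain ⟨u, hu⟩ := tot2 w
    exact ⟨u, uniq _ _ hu⟩
  · intro u
    rw [ker _ _ (hF u), ← hρk]; rfl

/-- The second cosyzygy is injective when the global dimension is at most 2. -/
theorem injective_cosyz (hgl : GlDimLE2 R)
    (a : I0 →ₗ[R] J0) (b : J0 →ₗ[R] J1)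
    (hI0 : Module.Injective R I0) (hJ0 : Module.Injective R J0)
    (hb : Function.Surjective b)
    (c1 : LinearMap.range a = LinearMap.ker b) : Module.Injective R J1 := by
  have y0 : ∀ x, b (a x) = 0 := fun x => by
    have : a x ∈ LinearMap.ker b := c1 ▸ LinearMap.mem_range_self _ _
    simpa using this
  constructor
  intro X' X _ _ _ _ f hf h
  obtain ⟨R2, R1, R0, r2, r1, r0, hR2, hR1, hR0, hr2, hr0, e1, e0⟩ :=
    hgl (ModuleCat.of R (X ⧸ LinearMap.range f))
  have z1 : ∀ x, r1 (r2 x) = 0 := fun x => by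
    have : r2 x ∈ LinearMap.ker r1 := e1 ▸ LinearMap.mem_range_self _ _
    simpa using this
  have z0 : ∀ x, r0 (r1 x) = 0 := fun x => by
    have : r1 x ∈ LinearMap.ker r0 := e0 ▸ LinearMap.mem_range_self _ _
    simpa using this
  have x1 : ∀ x, r1 x = 0 → ∃ y, r2 y = x := fun x hx => by
    have : x ∈ LinearMap.range r2 := by rw [e1]; simpa using hx
    exact this
  have x0 : ∀ x, r0 x = 0 → ∃ y, r1 y = x := fun x hx => by
    have : x ∈ LinearMap.range r1 := by rw [e0]; simpa using hx
    exact this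
  obtain ⟨ρ0, hρ0⟩ := Module.projective_lifting_property (LinearMap.range f).mkQ r0
    (Submodule.mkQ_surjective _)
  have hρ0 : ∀ x, (LinearMap.range f).mkQ (ρ0 x) = r0 x := LinearMap.congr_fun hρ0
  obtain ⟨ρ1, hρ1⟩ := lift_exact hR1 (ρ0.comp r1) f (fun x => by
    rw [← Submodule.ker_mkQ (LinearMap.range f)]
    change (LinearMap.range f).mkQ (ρ0 (r1 x)) = 0
    rw [hρ0, z0])
  have hρ1 : ∀ x, f (ρ1 x) = ρ0 (r1 x) := hρ1
  obtain ⟨a1, ha1⟩ := lift_exact hR1 (h.comp ρ1) b (fun x => hb _)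
  have ha1 : ∀ x, b (a1 x) = h (ρ1 x) := ha1
  obtain ⟨a2, ha2⟩ := lift_exact hR2 (a1.comp r2) a (fun x => by
    rw [c1]
    change b (a1 (r2 x)) = 0
    have : ρ1 (r2 x) = 0 := hf (by rw [hρ1, z1, map_zero, map_zero])
    rw [ha1, this, map_zero])
  obtain ⟨β, hβ⟩ := ext_exact hI0 r2 a2 (fun x hx => by
    have : x = 0 := hr2 (by rw [hx, map_zero])
    rw [this, map_zero])
  obtain ⟨γ, hγ⟩ := ext_exact hJ0 r1 (a1 - a.comp β) (fun x hx => by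
    obtain ⟨y, rfl⟩ := x1 x hx
    have := ha2 y
    simp only [LinearMap.comp_apply] at this
    simp [hβ, this])
  have key : ∀ x, b (γ (r1 x)) = h (ρ1 x) := fun x => by
    rw [hγ]; simp [y0, ha1]
  -- glue
  let σ : (X' × R0) →ₗ[R] X := f.coprod ρ0
  let τ : (X' × R0) →ₗ[R] J1 := h.coprod (b.comp γ)
  have hσ : Function.Surjective σ := by
    intro x
    obtain ⟨r, hr⟩ := hr0 ((LinearMap.range f).mkQ x)
    have : x - ρ0 r ∈ LinearMap.range f := by
      rw [← Submodule.ker_mkQ (LinearMap.range f), LinearMap.mem_ker, map_sub, hρ0, hr, sub_self]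
    obtain ⟨y, hy⟩ := this
    exact ⟨(y, r), by simp [σ, hy]⟩
  have hk : LinearMap.ker σ ≤ LinearMap.ker τ := by
    rintro ⟨y, r⟩ hyr
    have hyr : f y + ρ0 r = 0 := by simpa [σ] using hyr
    have h0 : r0 r = 0 := by
      rw [← hρ0, ← LinearMap.mem_ker, Submodule.ker_mkQ]
      exact ⟨-y, by rw [map_neg]; exact (eq_neg_of_add_eq_zero_right hyr).symm⟩
    obtain ⟨t, rfl⟩ := x0 r h0
    have : y = - ρ1 t := hf (by rw [map_neg, hρ1]; exact eq_neg_of_add_eq_zero_left hyr)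
    subst this
    simp [τ, key]
  let e := σ.quotKerEquivOfSurjective hσ
  refine ⟨((LinearMap.ker σ).liftQ τ hk).comp e.symm.toLinearMap, fun x => ?_⟩
  have : e.symm (f x) = (LinearMap.ker σ).mkQ (x, 0) := by
    rw [LinearEquiv.symm_apply_eq]; simp [e, σ]
  simp [this, τ]

end Balance


set_option linter.style.haveILetI false

section DualModules

variable {k : Type} [Field k] {A : Type} [Ring A] [Algebra k A]

/-- the `k`-structure of a module over a `k`-algebra. -/
@[reducible] def kMod (k : Type) [Field k] (A : Type) [Ring A] [Algebra k A]
    (M : Type) [AddCommGroup M] [Module A M] : Module k M :=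
  Module.compHom M (algebraMap k A)

theorem kTower (k : Type) [Field k] (A : Type) [Ring A] [Algebra k A]
    (M : Type) [AddCommGroup M] [Module A M] :
    letI := kMod k A M
    IsScalarTower k A M := by
  letI := kMod k A M
  refine ⟨fun c a m => ?_⟩
  change (c • a) • m = algebraMap k A c • (a • m)
  rw [Algebra.smul_def, mul_smul]

variable {Q : Type} [AddCommGroup Q] [Module k Q] [Module A Q] [IsScalarTower k A Q]

/-- the right module structure on the dual of a left module. -/
instance dualModule : Module Aᵐᵒᵖ (Q →ₗ[k] k) where
  smul a f :=
    { toFun := fun y => f (unop a • y)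
      map_add' := fun y z => by rw [smul_add, map_add]
      map_smul' := fun c y => by
        rw [← algebraMap_smul A c y, ← mul_smul, ← Algebra.commutes, mul_smul, algebraMap_smul,
          map_smul]; rfl }
  one_smul f := LinearMap.ext fun y => by
    change f ((1 : A) • y) = f y
    rw [one_smul]
  mul_smul a b f := LinearMap.ext fun y => by
    change f ((unop b * unop a) • y) = f (unop b • unop a • y)
    rw [mul_smul]
  smul_zero a := rfl
  smul_add a f g := rfl
  add_smul a b f := LinearMap.ext fun y => by
    change f ((unop a + unop b) • y) = f (unop a • y) + f (unop b • y)
    rw [add_smul, map_add]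
  zero_smul f := LinearMap.ext fun y => by
    change f ((0 : A) • y) = 0
    rw [zero_smul, map_zero]

theorem dual_smul_apply (a : Aᵐᵒᵖ) (f : Q →ₗ[k] k) (y : Q) : (a • f) y = f (unop a • y) := rfl

instance dualTower : IsScalarTower k Aᵐᵒᵖ (Q →ₗ[k] k) where
  smul_assoc c a f := LinearMap.ext fun y => by
    rw [dual_smul_apply, LinearMap.smul_apply, dual_smul_apply, unop_smul, smul_assoc, map_smul]

theorem dual_injective (hQ : Module.Projective A Q) [Module.Finite A Q] :
    Module.Injective Aᵐᵒᵖ (Q →ₗ[k] k) := by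
  obtain ⟨n, x, g, hx⟩ := exists_dual_basis (R := A) Q hQ
  constructor
  intro X' X _ _ _ _ f hf h
  letI := kMod k Aᵐᵒᵖ X'
  letI := kMod k Aᵐᵒᵖ X
  haveI := kTower k Aᵐᵒᵖ X'
  haveI := kTower k Aᵐᵒᵖ X
  obtain ⟨r, hr⟩ := (f.restrictScalars k).exists_leftInverse_of_injective
    (by rw [LinearMap.ker_eq_bot]; exact hf)
  have hr : ∀ z, r (f z) = z := LinearMap.congr_fun hr
  refine ⟨{ toFun := fun z =>
              { toFun := fun y => ∑ i, h (r (op (g i y) • z)) (x i)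
                map_add' := fun y y' => by
                  simp [add_smul, Finset.sum_add_distrib]
                map_smul' := fun c y => by
                  have : ∀ i, g i (c • y) = c • g i y := fun i =>
                    (g i).map_smul_of_tower c y
                  simp only [this, op_smul, smul_assoc, map_smul, RingHom.id_apply]
                  rw [Finset.smul_sum]
                  refine Finset.sum_congr rfl fun i _ => ?_
                  rw [h.map_smul_of_tower, LinearMap.smul_apply] }
            map_add' := fun z z' => LinearMap.ext fun y => by
              simp [Finset.sum_add_distrib]
            map_smul' := fun a z => LinearMap.ext fun y => by
              simp only [LinearMap.coe_mk, AddHom.coe_mk, RingHom.id_apply, dual_smul_apply,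
                map_smul, smul_eq_mul, op_mul, op_unop, mul_smul] }, fun z => ?_⟩
  refine LinearMap.ext fun y => ?_
  change ∑ i, h (r (op (g i y) • f z)) (x i) = h z y
  conv_rhs => rw [hx y, map_sum]
  refine Finset.sum_congr rfl fun i _ => ?_
  rw [← map_smul, hr, map_smul, dual_smul_apply, unop_op]

/-- dual map. -/
def dualMp {Q1 : Type} [AddCommGroup Q1] [Module k Q1] [Module A Q1] [IsScalarTower k A Q1]
    (δ : Q1 →ₗ[A] Q) : (Q →ₗ[k] k) →ₗ[Aᵐᵒᵖ] (Q1 →ₗ[k] k) where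
  toFun f := f.comp (δ.restrictScalars k)
  map_add' f g := rfl
  map_smul' a f := LinearMap.ext fun y => by
    simp [dual_smul_apply]

theorem dualMp_apply {Q1 : Type} [AddCommGroup Q1] [Module k Q1] [Module A Q1]
    [IsScalarTower k A Q1] (δ : Q1 →ₗ[A] Q) (f : Q →ₗ[k] k) (y : Q1) :
    dualMp δ f y = f (δ y) := rfl

theorem exists_functional {M : Type} [AddCommGroup M] [Module k M] (N : Submodule k M) (y : M)
    (hy : y ∉ N) : ∃ f : M →ₗ[k] k, f y ≠ 0 ∧ ∀ z ∈ N, f z = 0 := by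
  obtain ⟨f, hf, hN⟩ := Submodule.exists_le_ker_of_notMem hy
  exact ⟨f, hf, fun z hz => hN hz⟩

theorem delta_injective {Q1 : Type} [AddCommGroup Q1] [Module k Q1] [Module A Q1]
    [IsScalarTower k A Q1] [FiniteDimensional k Q1] (δ : Q1 →ₗ[A] Q)
    (hs : ∀ N : Submodule A Q1, N ⊔ LinearMap.ker δ = ⊤ → N = ⊤)
    (hK : Module.Injective Aᵐᵒᵖ (LinearMap.range (dualMp (k := k) δ))) :
    Function.Injective δ := by
  set K := LinearMap.range (dualMp (k := k) δ) with hKdef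
  obtain ⟨ρ, hρ⟩ := ext_exact hK K.subtype LinearMap.id (fun x hx => by simpa using hx)
  have hρ : ∀ x : K, ρ x = x := hρ
  -- annihilator of ker ρ
  let N : Submodule A Q1 :=
    { carrier := {y | ∀ f : Q1 →ₗ[k] k, ρ f = 0 → f y = 0}
      add_mem' := fun {y z} hy hz f hf => by rw [map_add, hy f hf, hz f hf, add_zero]
      zero_mem' := fun f _ => map_zero f
      smul_mem' := fun c y hy f hf => by
        have := hy (op c • f) (by rw [map_smul, hf, smul_zero])
        exact this }
  let Kk : Submodule k (Q1 →ₗ[k] k) :=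
    { carrier := {f | ρ f = 0}
      add_mem' := fun {f g} hf hg => by
        change ρ (f + g) = 0
        rw [map_add, show ρ f = 0 from hf, show ρ g = 0 from hg, add_zero]
      zero_mem' := map_zero ρ
      smul_mem' := fun c f hf => by
        change ρ (c • f) = 0
        rw [← algebraMap_smul Aᵐᵒᵖ c f, map_smul, show ρ f = 0 from hf, smul_zero] }
  -- functionals vanishing on N lie in ker ρ
  have hN : ∀ f : Q1 →ₗ[k] k, (∀ y ∈ N, f y = 0) → ρ f = 0 := by
    intro f hf
    have h1 : f ∈ Kk.dualCoannihilator.dualAnnihilator := by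
      rw [Submodule.mem_dualAnnihilator]
      intro y hy
      apply hf
      intro g hg
      exact (Submodule.mem_dualCoannihilator y).1 hy g hg
    rw [Subspace.dualCoannihilator_dualAnnihilator_eq] at h1
    exact h1
  -- functionals vanishing on ker δ lie in K
  have hKm : ∀ f : Q1 →ₗ[k] k, (∀ y, δ y = 0 → f y = 0) → f ∈ K := by
    intro f hf
    let δk : Q1 →ₗ[k] Q := δ.restrictScalars k
    have hkf : LinearMap.ker δk ≤ LinearMap.ker f := fun y hy => hf y hy
    obtain ⟨g, hg⟩ := ((LinearMap.ker δk).liftQ δk le_rfl).exists_leftInverse_of_injective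
      (Submodule.ker_liftQ_eq_bot _ _ _ le_rfl)
    refine ⟨((LinearMap.ker δk).liftQ f hkf).comp g, LinearMap.ext fun y => ?_⟩
    have h2 := LinearMap.congr_fun hg ((LinearMap.ker δk).mkQ y)
    have h3 : g (δ y) = (LinearMap.ker δk).mkQ y := h2
    rw [dualMp_apply, LinearMap.comp_apply, h3]
    simp
  have hNtop : N = ⊤ := by
    apply hs
    rw [eq_top_iff]
    intro y _
    by_contra hy
    obtain ⟨f, hfy, hf⟩ := exists_functional ((N ⊔ LinearMap.ker δ).restrictScalars k) y hy
    have hf1 : ρ f = 0 := hN f fun z hz => hf z (Submodule.mem_sup_left hz)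
    have hf2 : f ∈ K := hKm f fun z hz => hf z (Submodule.mem_sup_right (by simpa using hz))
    have : (⟨f, hf2⟩ : K) = 0 := by rw [← hρ ⟨f, hf2⟩]; exact hf1
    have hf0 : f = 0 := congrArg Subtype.val this
    exact hfy (by rw [hf0]; rfl)
  rw [injective_iff_map_eq_zero]
  intro y hy
  by_contra hy0
  obtain ⟨f, hfy, _⟩ := exists_functional (⊥ : Submodule k Q1) y (by simpa using hy0)
  -- f - ρ f is in ker ρ
  have h1 : ρ (f - (ρ f : Q1 →ₗ[k] k)) = 0 := by rw [map_sub, hρ, sub_self]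
  have h2 : (f - (ρ f : Q1 →ₗ[k] k)) y = 0 := by
    have hyN : y ∈ N := by rw [hNtop]; trivial
    exact hyN _ h1
  obtain ⟨g, hg⟩ := (ρ f).2
  have h3 : (ρ f : Q1 →ₗ[k] k) y = 0 := by
    rw [← hg, dualMp_apply, hy, map_zero]
  rw [LinearMap.sub_apply, h3, sub_zero] at h2
  exact hfy h2

/-- nondegenerate pairings are perfect. -/
theorem pairing_perfect {N M : Type} [AddCommGroup N] [AddCommGroup M] [Module Aᵐᵒᵖ N]
    [Module A M] [Module k N] [Module k M] [IsScalarTower k Aᵐᵒᵖ N] [IsScalarTower k A M]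
    (φ : N → M → k)
    (h1 : ∀ n n' m, φ (n + n') m = φ n m + φ n' m)
    (h2 : ∀ n m m', φ n (m + m') = φ n m + φ n m')
    (h3 : ∀ (c : k) n m, φ n ((algebraMap k A c) • m) = c * φ n m)
    (h4 : ∀ (a : A) n m, φ (op a • n) m = φ n (a • m))
    (h5 : ∀ n, (∀ m, φ n m = 0) → n = 0)
    (h6 : ∀ m, (∀ n, φ n m = 0) → m = 0)
    (hfin : FiniteDimensional k N ∨ FiniteDimensional k M) :
    FiniteDimensional k N ∧ FiniteDimensional k M ∧
    ∃ p : N →ₗ[k] M →ₗ[k] k, (∀ n m, p n m = φ n m) ∧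
      (∀ ξ : M →ₗ[k] k, ∃ n, ∀ m, φ n m = ξ m) ∧ (∀ ξ : N →ₗ[k] k, ∃ m, ∀ n, φ n m = ξ n) := by
  let p : N →ₗ[k] M →ₗ[k] k := LinearMap.mk₂ k φ h1
    (fun c n m => by
      rw [← algebraMap_smul Aᵐᵒᵖ c n, MulOpposite.algebraMap_apply, h4, h3]; rfl) h2
    (fun c n m => by rw [← algebraMap_smul A c m, h3]; rfl)
  have hp : ∀ n m, p n m = φ n m := fun n m => rfl
  have hi : Function.Injective p := by
    rw [injective_iff_map_eq_zero]
    exact fun n hn => h5 n fun m => LinearMap.congr_fun hn m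
  have hi' : Function.Injective p.flip := by
    rw [injective_iff_map_eq_zero]
    exact fun m hm => h6 m fun n => LinearMap.congr_fun hm n
  have hN : FiniteDimensional k N := by
    rcases hfin with h | h
    · exact h
    · exact FiniteDimensional.of_injective p hi
  have hM : FiniteDimensional k M := FiniteDimensional.of_injective p.flip hi'
  haveI : p.IsPerfPair := LinearMap.IsPerfPair.of_injective hi hi'
  refine ⟨hN, hM, p, hp, fun ξ => ?_, fun ξ => ?_⟩
  · obtain ⟨n, hn⟩ := (LinearMap.IsPerfPair.bijective_left p).2 ξ
    exact ⟨n, fun m => LinearMap.congr_fun hn m⟩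
  · obtain ⟨n, hn⟩ := (LinearMap.IsPerfPair.bijective_right p).2 ξ
    exact ⟨n, fun m => LinearMap.congr_fun hn m⟩

theorem injEnv_finite [FiniteDimensional k A] {M I : Type} [AddCommGroup M] [AddCommGroup I]
    [Module Aᵐᵒᵖ M] [Module Aᵐᵒᵖ I] [Module k M] [Module k I] [IsScalarTower k Aᵐᵒᵖ M]
    [IsScalarTower k Aᵐᵒᵖ I] [FiniteDimensional k M] (i : M →ₗ[Aᵐᵒᵖ] I)
    (hi : Function.Injective i)
    (he : ∀ K : Submodule Aᵐᵒᵖ I, K ⊓ LinearMap.range i = ⊥ → K = ⊥) :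
    FiniteDimensional k I := by
  let b := Module.finBasis k M
  let j : M →ₗ[Aᵐᵒᵖ] ((Fin (Module.finrank k M) → A) →ₗ[k] k) :=
    { toFun := fun m =>
        { toFun := fun c => ∑ t, b.coord t (op (c t) • m)
          map_add' := fun c c' => by simp [add_smul, Finset.sum_add_distrib]
          map_smul' := fun a c => by
            simp only [Pi.smul_apply, op_smul, smul_assoc, map_smul, RingHom.id_apply]
            rw [Finset.smul_sum] }
      map_add' := fun m m' => LinearMap.ext fun c => by
        simp [Finset.sum_add_distrib]
      map_smul' := fun a m => LinearMap.ext fun c => by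
        simp only [LinearMap.coe_mk, AddHom.coe_mk, RingHom.id_apply, dual_smul_apply,
          Pi.smul_apply, smul_eq_mul, op_mul, op_unop, mul_smul] }
  have hj : ∀ m, j m = 0 → m = 0 := by
    intro m hm
    apply b.ext_elem
    intro t
    have := LinearMap.congr_fun hm (Pi.single t 1)
    change ∑ s, b.coord s (op ((Pi.single t (1 : A) : Fin _ → A) s) • m) = 0 at this
    rw [Finset.sum_eq_single t] at this
    · simpa using this
    · intro s _ hs
      simp [Pi.single_eq_of_ne hs]
    · simp
  obtain ⟨l, hl⟩ := ext_exact (dual_injective (k := k) (A := A)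
    (Q := Fin (Module.finrank k M) → A) inferInstance) i j
    (fun x hx => by rw [hi (by rw [hx, map_zero] : i x = i 0), map_zero])
  have hlk : LinearMap.ker l = ⊥ := by
    apply he
    rw [eq_bot_iff]
    rintro x ⟨hx, m, rfl⟩
    have : j m = 0 := by rw [← hl]; exact hx
    simp [hj m this]
  exact FiniteDimensional.of_injective (l.restrictScalars k)
    (show Function.Injective l from LinearMap.ker_eq_bot.1 hlk)

end DualModules


set_option linter.style.haveILetI false

section ExtIso

variable {k : Type} [Field k] {C : Type} [Ring C] [Algebra k C] [FiniteDimensional k C]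

theorem ext_iso (DC : Mdl Cᵐᵒᵖ) (φ : DC → C → k)
    (p1 : ∀ n n' m, φ (n + n') m = φ n m + φ n' m)
    (p2 : ∀ n m m', φ n (m + m') = φ n m + φ n m')
    (p3 : ∀ (c : k) n m, φ n ((algebraMap k C c) * m) = c * φ n m)
    (p4 : ∀ (a : C) n m, φ (op a • n) m = φ n (a * m))
    (p5 : ∀ n, (∀ m, φ n m = 0) → n = 0)
    (p6 : ∀ m, (∀ n, φ n m = 0) → m = 0)
    (P2 P1 P0 : Mdl Cᵐᵒᵖ) (d2 : P2 →ₗ[Cᵐᵒᵖ] P1) (d1 : P1 →ₗ[Cᵐᵒᵖ] P0)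
    (d0 : P0 →ₗ[Cᵐᵒᵖ] DC)
    (hP2 : Module.Projective Cᵐᵒᵖ P2) (hP1 : Module.Projective Cᵐᵒᵖ P1)
    (hP0 : Module.Projective Cᵐᵒᵖ P0)
    (hd2 : Function.Injective d2) (hd0 : Function.Surjective d0)
    (e1 : LinearMap.range d2 = LinearMap.ker d1)
    (e0 : LinearMap.range d1 = LinearMap.ker d0)
    (hgl : GlDimLE2 Cᵐᵒᵖ) (P : Mdl Cᵐᵒᵖ) [Module.Finite Cᵐᵒᵖ P]
    (W : Mdl Cᵐᵒᵖ) (hW : IsTauInvCosyz k C P W) :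
    ∃ Φ : (P2 →ₗ[Cᵐᵒᵖ] P) →+ W, Function.Surjective Φ ∧
      (∀ u, Φ u = 0 ↔ ∃ f : P1 →ₗ[Cᵐᵒᵖ] P, u = f.comp d2) ∧
      ∀ (c : C) (μ : DC →ₗ[Cᵐᵒᵖ] DC) (f0 : P0 →ₗ[Cᵐᵒᵖ] P0)
            (f1 : P1 →ₗ[Cᵐᵒᵖ] P1) (f2 : P2 →ₗ[Cᵐᵒᵖ] P2),
          (∀ n x, φ (μ n) x = φ n (x * c)) →
          d0.comp f0 = μ.comp d0 →
          d1.comp f1 = f0.comp d1 →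
          d2.comp f2 = f1.comp d2 → ∀ u, Φ (u.comp f2) = op c • Φ u := by
  obtain ⟨V, ⟨I0, i, ⟨hI0, hi, hess⟩, ⟨e⟩⟩, DM, ⟨ψ, s1, s2, s3, s4, s5, s6⟩,
    Q1, Q0, δ1, δ0, ⟨⟨hQ0, hδ0, hsup0⟩, hQ1, hex, hsup1⟩, r, hr, hrk⟩ := hW
  letI := kMod k Cᵐᵒᵖ P
  letI := kMod k Cᵐᵒᵖ I0
  letI := kMod k Cᵐᵒᵖ V
  letI := kMod k Cᵐᵒᵖ DC
  letI := kMod k C DM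
  letI := kMod k C Q0
  letI := kMod k C Q1
  haveI := kTower k Cᵐᵒᵖ P
  haveI := kTower k Cᵐᵒᵖ I0
  haveI := kTower k Cᵐᵒᵖ V
  haveI := kTower k Cᵐᵒᵖ DC
  haveI := kTower k C DM
  haveI := kTower k C Q0
  haveI := kTower k C Q1
  haveI : Module.Finite k Cᵐᵒᵖ := Module.Finite.equiv (MulOpposite.opLinearEquiv k)
  haveI : IsNoetherianRing C := IsNoetherianRing.of_finite k C
  haveI : FiniteDimensional k P := Module.Finite.trans Cᵐᵒᵖ P
  haveI : FiniteDimensional k I0 := injEnv_finite i hi hess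
  -- projection I0 → V
  let π : I0 →ₗ[Cᵐᵒᵖ] V := e.symm.toLinearMap.comp (LinearMap.range i).mkQ
  have hπs : Function.Surjective π := e.symm.surjective.comp (Submodule.mkQ_surjective _)
  have hπk : ∀ x, π x = 0 ↔ ∃ y, i y = x := by
    intro x
    simp [π]
  haveI : FiniteDimensional k V := Module.Finite.of_surjective (π.restrictScalars k) hπs
  obtain ⟨_, hDMfin, pV, hpV, perf1, _⟩ := pairing_perfect ψ s1 s2 s3 s4 s5 s6 (Or.inl inferInstance)
  obtain ⟨hDCfin, _, pC, hpC, _, perfC⟩ := pairing_perfect (A := C) (M := C) φ p1 p2 p3 p4 p5 p6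
    (Or.inr inferInstance)
  haveI : Module.Finite C DM := Module.Finite.of_restrictScalars_finite k C DM
  haveI : Module.Finite C Q0 := finite_of_cover δ0 hδ0 hsup0
  haveI : Module.Finite C Q1 := by
    refine finite_of_cover δ1.rangeRestrict δ1.surjective_rangeRestrict ?_
    intro N hN
    rw [LinearMap.ker_rangeRestrict] at hN
    exact hsup1 N hN
  haveI : FiniteDimensional k Q0 := Module.Finite.trans C Q0
  haveI : FiniteDimensional k Q1 := Module.Finite.trans C Q1
  have hJ0 : Module.Injective Cᵐᵒᵖ (Q0 →ₗ[k] k) := dual_injective hQ0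
  -- the map a
  let a : I0 →ₗ[Cᵐᵒᵖ] (Q0 →ₗ[k] k) :=
    { toFun := fun x => (pV (π x)).comp (δ0.restrictScalars k)
      map_add' := fun x y => by simp [LinearMap.add_comp]
      map_smul' := fun c x => LinearMap.ext fun y => by
        rw [RingHom.id_apply, dual_smul_apply]
        simp only [LinearMap.comp_apply, LinearMap.coe_restrictScalars, hpV, map_smul]
        rw [← s4, op_unop] }
  have ha : ∀ x y, a x y = ψ (π x) (δ0 y) := fun x y => hpV _ _
  let b : (Q0 →ₗ[k] k) →ₗ[Cᵐᵒᵖ] (Q1 →ₗ[k] k) := dualMp δ1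
  have hb' : ∀ f y, b f y = f (δ1 y) := fun f y => rfl
  have hz : ∀ y, δ0 (δ1 y) = 0 := fun y => by
    have : δ1 y ∈ LinearMap.ker δ0 := hex ▸ LinearMap.mem_range_self _ _
    simpa using this
  have hψ0 : ∀ n, ψ n 0 = 0 := fun n => by rw [← hpV, map_zero]
  have c0 : LinearMap.range i = LinearMap.ker a := by
    ext x
    rw [LinearMap.mem_ker, LinearMap.mem_range, ← hπk]
    constructor
    · intro hx
      refine LinearMap.ext fun y => ?_
      rw [ha, hx, ← hpV, map_zero]; rfl
    · intro hx
      apply s5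
      intro m
      obtain ⟨y, rfl⟩ := hδ0 m
      rw [← ha, hx]; rfl
  have c1 : LinearMap.range a = LinearMap.ker b := by
    ext f
    rw [LinearMap.mem_ker, LinearMap.mem_range]
    constructor
    · rintro ⟨x, rfl⟩
      refine LinearMap.ext fun y => ?_
      rw [hb', ha, hz, hψ0]; rfl
    · intro hf
      have hk : LinearMap.ker (δ0.restrictScalars k) ≤ LinearMap.ker f := by
        intro y hy
        have hy' : y ∈ LinearMap.range δ1 := by rw [hex]; exact hy
        obtain ⟨z, rfl⟩ := hy'
        rw [LinearMap.mem_ker, ← hb', hf]; rfl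
      let eq := (δ0.restrictScalars k).quotKerEquivOfSurjective hδ0
      obtain ⟨v, hv⟩ := perf1 (((LinearMap.ker (δ0.restrictScalars k)).liftQ f hk).comp
        eq.symm.toLinearMap)
      obtain ⟨x, rfl⟩ := hπs v
      refine ⟨x, LinearMap.ext fun y => ?_⟩
      rw [ha, hv]
      have : eq.symm (δ0 y) = (LinearMap.ker (δ0.restrictScalars k)).mkQ y := by
        rw [LinearEquiv.symm_apply_eq]; rfl
      rw [LinearMap.comp_apply, LinearEquiv.coe_coe, this]
      rfl
  have hK : Module.Injective Cᵐᵒᵖ (LinearMap.range b) := by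
    refine injective_cosyz hgl a b.rangeRestrict hI0 hJ0 b.surjective_rangeRestrict ?_
    rw [LinearMap.ker_rangeRestrict, c1]
  have hδ1 : Function.Injective δ1 := delta_injective δ1 hsup1 hK
  have hb : Function.Surjective b := by
    intro f
    obtain ⟨g, hg⟩ := (δ1.restrictScalars k).exists_leftInverse_of_injective
      (by rw [LinearMap.ker_eq_bot]; exact hδ1)
    refine ⟨f.comp g, LinearMap.ext fun y => ?_⟩
    rw [hb', LinearMap.comp_apply]
    exact congrArg f (LinearMap.congr_fun hg y)
  -- the transposition bijection
  have bij : ∀ (Q : Mdl C) (_ : Module k Q) (_ : IsScalarTower k C Q)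
      (w' : DC →ₗ[Cᵐᵒᵖ] (Q →ₗ[k] k)), ∃ w : Q →ₗ[C] C, ∀ n y, φ n (w y) = w' n y := by
    intro Q _ _ w'
    have h : ∀ y, ∃ c, ∀ n, φ n c = w' n y := fun y =>
      perfC ((LinearMap.applyₗ y).comp (w'.restrictScalars k))
    choose w hw using h
    have uniq : ∀ c c', (∀ n, φ n c = φ n c') → c = c' := fun c c' h => by
      rw [← sub_eq_zero]
      apply p6
      intro n
      rw [← hpC, map_sub, hpC, hpC, h, sub_self]
    refine ⟨{ toFun := w, map_add' := fun y z => uniq _ _ fun n => ?_,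
              map_smul' := fun c y => uniq _ _ fun n => ?_ }, fun n y => hw y n⟩
    · rw [p2, hw, hw, hw, map_add]
    · rw [RingHom.id_apply, smul_eq_mul, ← p4, hw, hw, LinearMap.map_smul w']; rfl
  have inj : ∀ (Q : Mdl C) (w w' : Q →ₗ[C] C), (∀ n y, φ n (w y) = φ n (w' y)) → w = w' := by
    intro Q w w' h
    refine LinearMap.ext fun y => ?_
    rw [← sub_eq_zero]
    apply p6
    intro n
    rw [← hpC, map_sub, hpC, hpC, h, sub_self]
  have back : ∀ (Q : Mdl C) (_ : Module k Q) (_ : IsScalarTower k C Q)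
      (w : Q →ₗ[C] C), ∃ w' : DC →ₗ[Cᵐᵒᵖ] (Q →ₗ[k] k), ∀ n y, w' n y = φ n (w y) := by
    intro Q _ _ w
    refine ⟨{ toFun := fun n => (pC n).comp (w.restrictScalars k)
              map_add' := fun x y => by simp [LinearMap.add_comp]
              map_smul' := fun c x => LinearMap.ext fun y => ?_ }, fun n y => hpC _ _⟩
    rw [RingHom.id_apply, dual_smul_apply]
    simp only [LinearMap.comp_apply, LinearMap.coe_restrictScalars, hpC, map_smul]
    rw [smul_eq_mul, ← p4, op_unop]
  choose τ hτ using bij Q1 inferInstance inferInstance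
  let ρ : (DC →ₗ[Cᵐᵒᵖ] (Q1 →ₗ[k] k)) →+ W := AddMonoidHom.mk' (fun w' => r (τ w'))
    (fun w w' => by
      rw [← map_add]
      congr 1
      apply inj
      intro n y
      have h' : (τ w + τ w') y = τ w y + τ w' y := rfl
      rw [hτ, h', p2, hτ, hτ]; rfl)
  have hρ : ∀ w w', (∀ n y, φ n (w y) = w' n y) → ρ w' = r w := by
    intro w w' h
    change r (τ w') = r w
    congr 1
    apply inj
    intro n y
    rw [hτ, h]
  have hρs : Function.Surjective ρ := by
    intro x
    obtain ⟨w, rfl⟩ := hr x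
    obtain ⟨w', hw'⟩ := back Q1 inferInstance inferInstance w
    exact ⟨w', hρ _ _ fun n y => (hw' n y).symm⟩
  have hρk : ∀ w, ρ w = 0 ↔ ∃ l : DC →ₗ[Cᵐᵒᵖ] (Q0 →ₗ[k] k), w = b.comp l := by
    intro w
    change r (τ w) = 0 ↔ _
    rw [hrk]
    constructor
    · rintro ⟨f, hf⟩
      obtain ⟨l, hl⟩ := back Q0 inferInstance inferInstance f
      refine ⟨l, LinearMap.ext fun n => LinearMap.ext fun y => ?_⟩
      rw [← hτ, hf, LinearMap.comp_apply, LinearMap.comp_apply, hb', hl]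
    · rintro ⟨l, rfl⟩
      obtain ⟨f, hf⟩ := bij Q0 inferInstance inferInstance l
      refine ⟨f, inj _ _ _ fun n y => ?_⟩
      rw [hτ, LinearMap.comp_apply, LinearMap.comp_apply, hb', hf]
  obtain ⟨Φ, hΦs, hΦk, hΦr, hΦt⟩ := balance d2 d1 d0 i a b hP2 hP1 hP0 hI0 hJ0 hd2 hd0 e1 e0 hi hb
    c0 c1 ρ hρs hρk
  refine ⟨Φ, hΦs, hΦk, ?_⟩
  intro c μ f0 f1 f2 hμ g0 g1 g2 u
  obtain ⟨w, v1, v0, k1, k2, k3⟩ := hΦt u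
  rw [hΦr u w ⟨v1, v0, k1, k2, k3⟩]
  have g0 : ∀ x, d0 (f0 x) = μ (d0 x) := LinearMap.congr_fun g0
  have g1 : ∀ x, d1 (f1 x) = f0 (d1 x) := LinearMap.congr_fun g1
  have g2 : ∀ x, d2 (f2 x) = f1 (d2 x) := LinearMap.congr_fun g2
  rw [hΦr (u.comp f2) (w.comp μ) ⟨v1.comp f1, v0.comp f0,
    fun x => by simp [← g2, k1], fun x => by simp [← g1, k2], fun x => by simp [← g0, k3]⟩]
  change _ = op c • r (τ w)
  rw [← map_smul]
  apply hρ
  intro n y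
  rw [LinearMap.comp_apply, ← hτ, hμ]
  rfl

end ExtIso


set_option linter.style.haveILetI false

section ExtFinite

theorem exists_cover_ker {R : Type} [Ring R] [IsNoetherianRing R] {X Y : Type} [AddCommGroup X]
    [AddCommGroup Y] [Module R X] [Module R Y] [Module.Finite R X] (D : X →ₗ[R] Y) :
    ∃ (n : ℕ) (D' : (Fin n → R) →ₗ[R] X), (∀ y, D y = 0 → y ∈ LinearMap.range D') ∧
      ∀ y, D (D' y) = 0 := by
  obtain ⟨n, D1, hD1⟩ := Module.Finite.exists_fin' R (LinearMap.ker D)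
  refine ⟨n, (LinearMap.ker D).subtype.comp D1, fun y hy => ?_, fun y => (D1 y).2⟩
  obtain ⟨t, ht⟩ := hD1 ⟨y, hy⟩
  exact ⟨t, congrArg Subtype.val ht⟩

theorem ext2_finite {C : Type} [Ring C] [IsNoetherianRing Cᵐᵒᵖ]
    {E : Type} [AddCommGroup E] [Module C E]
    (DC P2 P1 P0 : Mdl Cᵐᵒᵖ) [Module.Finite Cᵐᵒᵖ DC]
    (d2 : P2 →ₗ[Cᵐᵒᵖ] P1) (d1 : P1 →ₗ[Cᵐᵒᵖ] P0) (d0 : P0 →ₗ[Cᵐᵒᵖ] DC)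
    (hP2 : Module.Projective Cᵐᵒᵖ P2) (hP1 : Module.Projective Cᵐᵒᵖ P1)
    (hP0 : Module.Projective Cᵐᵒᵖ P0)
    (hd2 : Function.Injective d2) (hd0 : Function.Surjective d0)
    (e1 : LinearMap.range d2 = LinearMap.ker d1)
    (e0 : LinearMap.range d1 = LinearMap.ker d0)
    (q : (P2 →ₗ[Cᵐᵒᵖ] C) →ₗ[C] E) (hq : Function.Surjective q)
    (hqk : ∀ g : P2 →ₗ[Cᵐᵒᵖ] C, q g = 0 ↔ ∃ f : P1 →ₗ[Cᵐᵒᵖ] C, g = f.comp d2) :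
    Module.Finite C E := by
  have z1 : ∀ x, d1 (d2 x) = 0 := fun x => by
    have : d2 x ∈ LinearMap.ker d1 := e1 ▸ LinearMap.mem_range_self d2 x
    exact this
  have z0 : ∀ x, d0 (d1 x) = 0 := fun x => by
    have : d1 x ∈ LinearMap.ker d0 := e0 ▸ LinearMap.mem_range_self d1 x
    exact this
  obtain ⟨n0, D0, hD0⟩ := Module.Finite.exists_fin' Cᵐᵒᵖ DC
  obtain ⟨n1, D1', x0, w0⟩ := exists_cover_ker D0
  obtain ⟨n2, D2', x1, w1⟩ := exists_cover_ker D1'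
  have y0 : ∀ y, d0 y = 0 → y ∈ LinearMap.range d1 := fun y hy => e0 ▸ hy
  have y1 : ∀ y, d1 y = 0 → y ∈ LinearMap.range d2 := fun y hy => e1 ▸ hy
  obtain ⟨b0, hb0⟩ := lift_exact hP0 d0 D0 (fun a => hD0 _)
  obtain ⟨b1, hb1⟩ := lift_exact hP1 (b0.comp d1) D1' (fun a => x0 _ (by
    rw [LinearMap.comp_apply, hb0, z0]))
  obtain ⟨b2, hb2⟩ := lift_exact hP2 (b1.comp d2) D2' (fun a => x1 _ (by
    rw [LinearMap.comp_apply, hb1, LinearMap.comp_apply, z1, map_zero]))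
  obtain ⟨a0, ha0⟩ := lift_exact (A := Fin n0 → Cᵐᵒᵖ) inferInstance D0 d0 (fun a => hd0 _)
  obtain ⟨a1, ha1⟩ := lift_exact (A := Fin n1 → Cᵐᵒᵖ) inferInstance (a0.comp D1') d1
    (fun a => y0 _ (by rw [LinearMap.comp_apply, ha0, w0]))
  obtain ⟨a2, ha2⟩ := lift_exact (A := Fin n2 → Cᵐᵒᵖ) inferInstance (a1.comp D2') d2
    (fun a => y1 _ (by rw [LinearMap.comp_apply, ha1, LinearMap.comp_apply, w1, map_zero]))
  obtain ⟨h0, hh0⟩ := lift_exact hP0 (LinearMap.id - a0.comp b0) d1 (fun a => y0 _ (by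
    simp [ha0, hb0]))
  obtain ⟨h1, hh1⟩ := lift_exact hP1 (LinearMap.id - a1.comp b1 - h0.comp d1) d2
    (fun a => y1 _ (by simp [ha1, hb1, hh0]))
  have key : ∀ x, x - a2 (b2 x) = h1 (d2 x) := fun x => hd2 (by
    rw [hh1, map_sub, ha2]
    simp [hb2, z1])
  let co : Fin n2 → ((Fin n2 → Cᵐᵒᵖ) →ₗ[Cᵐᵒᵖ] C) := fun i =>
    { toFun := fun y => unop (y i)
      map_add' := fun _ _ => rfl
      map_smul' := fun c y => rfl }
  classical
  refine (Module.finite_def (R := C) (M := E)).2 ⟨Finset.univ.image fun i => q ((co i).comp b2), ?_⟩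
  rw [eq_top_iff]
  rintro x -
  obtain ⟨g, rfl⟩ := hq x
  have h2 : q g = q ((g.comp a2).comp b2) := by
    rw [← sub_eq_zero, ← map_sub, hqk]
    exact ⟨g.comp h1, LinearMap.ext fun x => by simp [← key]⟩
  have h3 : (g.comp a2).comp b2 = ∑ i, (g (a2 (Pi.single i 1))) • ((co i).comp b2) := by
    refine LinearMap.ext fun x => ?_
    have h4 : b2 x = ∑ i, (b2 x i) • (Pi.single i (1 : Cᵐᵒᵖ) : Fin n2 → Cᵐᵒᵖ) := by
      funext j
      simp [Finset.sum_apply, Pi.single_apply]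
    rw [LinearMap.comp_apply, LinearMap.comp_apply, LinearMap.sum_apply]
    conv_lhs => rw [h4]
    rw [map_sum, map_sum]
    refine Finset.sum_congr rfl fun i _ => ?_
    rw [map_smul, map_smul]
    rfl
  rw [h2, h3, map_sum]
  refine Submodule.sum_mem _ fun i _ => ?_
  rw [map_smul]
  exact Submodule.smul_mem _ _ (Submodule.subset_span (by simp))

end ExtFinite


set_option linter.style.haveILetI false

section Balanced

variable {C : Type} [Ring C] {E : Type} [AddCommGroup E] [Module C E] [Module Cᵐᵒᵖ E]
  {P : Type} [AddCommGroup P] [Module Cᵐᵒᵖ P] {Z : Type} [AddCommGroup Z] [Module Cᵐᵒᵖ Z]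

/-- balanced biadditive right-linear maps `P × E → Z`. -/
structure IsBal (β : P → E → Z) : Prop where
  addl : ∀ p p' e, β (p + p') e = β p e + β p' e
  addr : ∀ p e e', β p (e + e') = β p e + β p e'
  bal : ∀ (c : C) p e, β (op c • p) e = β p (c • e)
  smul : ∀ (c : C) p e, β p (op c • e) = op c • β p e

theorem IsBal.zeror {β : P → E → Z} (h : IsBal (C := C) β) (p : P) : β p 0 = 0 := by
  have := h.addr p 0 0
  simpa using this

theorem IsBal.zerol {β : P → E → Z} (h : IsBal (C := C) β) (e : E) : β 0 e = 0 := by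
  have := h.addl 0 0 e
  simpa using this

/-- the map `x ↦ p · g(x)`. -/
def dotp {X : Type} [AddCommGroup X] [Module Cᵐᵒᵖ X] (p : P) (g : X →ₗ[Cᵐᵒᵖ] C) :
    X →ₗ[Cᵐᵒᵖ] P where
  toFun x := op (g x) • p
  map_add' x y := by rw [map_add, MulOpposite.op_add, add_smul]
  map_smul' c x := by
    rw [map_smul, RingHom.id_apply, ← mul_smul]
    rfl

theorem dotp_apply {X : Type} [AddCommGroup X] [Module Cᵐᵒᵖ X] (p : P) (g : X →ₗ[Cᵐᵒᵖ] C) (x : X) :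
    dotp p g x = op (g x) • p := rfl

/-- a functional with values in the ring, considered as a right module. -/
def toC (f : P →ₗ[Cᵐᵒᵖ] Cᵐᵒᵖ) : P →ₗ[Cᵐᵒᵖ] C where
  toFun x := unop (f x)
  map_add' x y := by rw [map_add]; rfl
  map_smul' c x := by rw [map_smul]; rfl

theorem exists_dual_basis_op (Q : Type) [AddCommGroup Q] [Module Cᵐᵒᵖ Q]
    (hQ : Module.Projective Cᵐᵒᵖ Q) [Module.Finite Cᵐᵒᵖ Q] :
    ∃ (n : ℕ) (x : Fin n → Q) (f : Fin n → (Q →ₗ[Cᵐᵒᵖ] C)), ∀ y, y = ∑ i, op (f i y) • x i := by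
  obtain ⟨n, x, f, h⟩ := exists_dual_basis (R := Cᵐᵒᵖ) Q hQ
  exact ⟨n, x, fun i => toC (f i), h⟩

theorem hom_to_bal {P2 P1 W : Type} [AddCommGroup P2] [Module Cᵐᵒᵖ P2] [AddCommGroup P1]
    [Module Cᵐᵒᵖ P1] [AddCommGroup W] [Module Cᵐᵒᵖ W] (d2 : P2 →ₗ[Cᵐᵒᵖ] P1)
    (hP : Module.Projective Cᵐᵒᵖ P) [Module.Finite Cᵐᵒᵖ P]
    (Φ : (P2 →ₗ[Cᵐᵒᵖ] P) →+ W) (hΦ : Function.Surjective Φ)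
    (hΦk : ∀ u, Φ u = 0 ↔ ∃ f : P1 →ₗ[Cᵐᵒᵖ] P, u = f.comp d2)
    (q : (P2 →ₗ[Cᵐᵒᵖ] C) →ₗ[C] E) (hq : Function.Surjective q)
    (hqk : ∀ g : P2 →ₗ[Cᵐᵒᵖ] C, q g = 0 ↔ ∃ f : P1 →ₗ[Cᵐᵒᵖ] C, g = f.comp d2)
    (hact : ∀ c : C, ∃ f2 : P2 →ₗ[Cᵐᵒᵖ] P2, (∀ u, Φ (u.comp f2) = op c • Φ u) ∧
      ∀ g : P2 →ₗ[Cᵐᵒᵖ] C, q (g.comp f2) = op c • q g)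
    (h : W →ₗ[Cᵐᵒᵖ] Z) (hh : h ≠ 0) :
    ∃ β : P → E → Z, IsBal (C := C) β ∧ ∃ p e, β p e ≠ 0 := by
  choose s hs using hq
  let β : P → E → Z := fun p e => h (Φ (dotp p (s e)))
  have hβ : ∀ p g, β p (q g) = h (Φ (dotp p g)) := by
    intro p g
    change h (Φ (dotp p (s (q g)))) = _
    congr 1
    rw [← sub_eq_zero, ← map_sub, hΦk]
    have h1 : q (s (q g) - g) = 0 := by rw [map_sub, hs, sub_self]
    obtain ⟨f, hf⟩ := (hqk _).1 h1
    refine ⟨dotp p f, LinearMap.ext fun x => ?_⟩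
    rw [LinearMap.sub_apply, dotp_apply, dotp_apply, ← sub_smul, ← MulOpposite.op_sub, ← LinearMap.sub_apply,
      hf]
    rfl
  have hs' : ∀ e, ∃ g, q g = e := fun e => ⟨s e, hs e⟩
  refine ⟨β, ⟨?_, ?_, ?_, ?_⟩, ?_⟩
  · intro p p' e
    change h (Φ _) = h (Φ _) + h (Φ _)
    rw [← map_add, ← map_add]
    congr 2
    refine LinearMap.ext fun x => ?_
    rw [LinearMap.add_apply, dotp_apply, dotp_apply, dotp_apply, smul_add]
  · intro p e e'
    obtain ⟨g, rfl⟩ := hs' e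
    obtain ⟨g', rfl⟩ := hs' e'
    rw [← map_add, hβ, hβ, hβ, ← map_add, ← map_add]
    congr 2
    refine LinearMap.ext fun x => ?_
    rw [LinearMap.add_apply, dotp_apply, dotp_apply, dotp_apply, ← add_smul]
    rfl
  · intro c p e
    obtain ⟨g, rfl⟩ := hs' e
    rw [← map_smul, hβ, hβ]
    congr 2
    refine LinearMap.ext fun x => ?_
    rw [dotp_apply, dotp_apply, ← mul_smul]
    rfl
  · intro c p e
    obtain ⟨g, rfl⟩ := hs' e
    obtain ⟨f2, h1, h2⟩ := hact c
    rw [← h2, hβ, hβ, ← map_smul, ← h1]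
    rfl
  · by_contra hcon
    push Not at hcon
    apply hh
    refine LinearMap.ext fun w => ?_
    obtain ⟨u, rfl⟩ := hΦ w
    obtain ⟨n, x, f, hx⟩ := exists_dual_basis_op P hP
    have hu : u = ∑ i, dotp (x i) ((f i).comp u) := by
      refine LinearMap.ext fun y => ?_
      rw [LinearMap.sum_apply]
      exact hx (u y)
    rw [hu, map_sum, map_sum]
    refine Finset.sum_eq_zero fun i _ => ?_
    rw [← hβ]
    exact hcon _ _

theorem bal_to_hom {P2 P1 W : Type} [AddCommGroup P2] [Module Cᵐᵒᵖ P2] [AddCommGroup P1]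
    [Module Cᵐᵒᵖ P1] [AddCommGroup W] [Module Cᵐᵒᵖ W] (d2 : P2 →ₗ[Cᵐᵒᵖ] P1)
    (hP : Module.Projective Cᵐᵒᵖ P) [Module.Finite Cᵐᵒᵖ P]
    (Φ : (P2 →ₗ[Cᵐᵒᵖ] P) →+ W) (hΦ : Function.Surjective Φ)
    (hΦk : ∀ u, Φ u = 0 ↔ ∃ f : P1 →ₗ[Cᵐᵒᵖ] P, u = f.comp d2)
    (q : (P2 →ₗ[Cᵐᵒᵖ] C) →ₗ[C] E) (hq : Function.Surjective q)
    (hqk : ∀ g : P2 →ₗ[Cᵐᵒᵖ] C, q g = 0 ↔ ∃ f : P1 →ₗ[Cᵐᵒᵖ] C, g = f.comp d2)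
    (hact : ∀ c : C, ∃ f2 : P2 →ₗ[Cᵐᵒᵖ] P2, (∀ u, Φ (u.comp f2) = op c • Φ u) ∧
      ∀ g : P2 →ₗ[Cᵐᵒᵖ] C, q (g.comp f2) = op c • q g)
    (β : P → E → Z) (hβ : IsBal (C := C) β) (hn : ∃ p e, β p e ≠ 0) :
    ∃ h : W →ₗ[Cᵐᵒᵖ] Z, h ≠ 0 := by
  obtain ⟨n, x, f, hx⟩ := exists_dual_basis_op P hP
  let H : (P2 →ₗ[Cᵐᵒᵖ] P) →+ Z := AddMonoidHom.mk' (fun u => ∑ i, β (x i) (q ((f i).comp u)))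
    (fun u v => by
      rw [← Finset.sum_add_distrib]
      refine Finset.sum_congr rfl fun i _ => ?_
      rw [← hβ.addr, ← map_add, LinearMap.comp_add])
  have hH : ∀ u, H u = ∑ i, β (x i) (q ((f i).comp u)) := fun u => rfl
  choose s hs using hΦ
  have hHs : ∀ u, H (s (Φ u)) = H u := by
    intro u
    have h1 : Φ (s (Φ u) - u) = 0 := by rw [map_sub, hs, sub_self]
    obtain ⟨v, hv⟩ := (hΦk _).1 h1
    rw [← sub_eq_zero, ← map_sub, hv, hH]
    refine Finset.sum_eq_zero fun i _ => ?_
    rw [show q ((f i).comp (v.comp d2)) = 0 from (hqk _).2 ⟨(f i).comp v, rfl⟩, hβ.zeror]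
  have hs' : ∀ w, ∃ u, Φ u = w := fun w => ⟨s w, hs w⟩
  refine ⟨{ toFun := fun w => H (s w), map_add' := ?_, map_smul' := ?_ }, fun h0 => ?_⟩
  · intro w w'
    obtain ⟨u, rfl⟩ := hs' w
    obtain ⟨v, rfl⟩ := hs' w'
    rw [← map_add, hHs, hHs, hHs, map_add]
  · intro c w
    obtain ⟨u, rfl⟩ := hs' w
    obtain ⟨f2, h1, h2⟩ := hact (unop c)
    rw [op_unop] at h1 h2
    rw [← h1, hHs, hHs, hH, hH, RingHom.id_apply, Finset.smul_sum]
    refine Finset.sum_congr rfl fun i _ => ?_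
    rw [← LinearMap.comp_assoc, h2, ← op_unop c, hβ.smul]
  · obtain ⟨p, e, hpe⟩ := hn
    obtain ⟨g, rfl⟩ := hq e
    apply hpe
    have h1 : H (s (Φ (dotp p g))) = 0 := LinearMap.congr_fun h0 (Φ (dotp p g))
    rw [hHs, hH] at h1
    have h2 : ∀ i, q ((f i).comp (dotp p g)) = f i p • q g := fun i => by
      rw [← map_smul]
      congr 1
      refine LinearMap.ext fun y => ?_
      rw [LinearMap.comp_apply, dotp_apply, map_smul]
      rfl
    let B : P →+ Z := AddMonoidHom.mk' (fun p => β p (q g)) (fun p p' => hβ.addl p p' _)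
    change B p = 0
    rw [hx p, map_sum, ← h1]
    refine Finset.sum_congr rfl fun i _ => ?_
    rw [h2]
    exact hβ.bal _ _ _

end Balanced


set_option linter.style.haveILetI false

section BSide

open TrivSqZeroExt

variable {C : Type} [Ring C] {E : Type} [AddCommGroup E] [Module C E] [Module Cᵐᵒᵖ E]
  [SMulCommClass C Cᵐᵒᵖ E]
  {P : Type} [AddCommGroup P] [Module Cᵐᵒᵖ P] {Z : Type} [AddCommGroup Z] [Module Cᵐᵒᵖ Z]

/-- the extension of `P` by `Z` over the trivial extension defined by a balanced map. -/
@[reducible] def balMod (β : P → E → Z) (hβ : IsBal (C := C) β) :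
    Module (TrivSqZeroExt C E)ᵐᵒᵖ (P × Z) where
  smul b x := (op (unop b).fst • x.1, op (unop b).fst • x.2 + β x.1 (unop b).snd)
  one_smul x := by
    change (op (1 : C) • x.1, op (1 : C) • x.2 + β x.1 0) = x
    rw [hβ.zeror, op_one, one_smul, one_smul, add_zero]
  mul_smul b b' x := by
    change (op ((unop b').fst * (unop b).fst) • x.1, op ((unop b').fst * (unop b).fst) • x.2 +
        β x.1 ((unop b').fst • (unop b).snd + op (unop b).fst • (unop b').snd)) =
      (op (unop b).fst • op (unop b').fst • x.1,
        op (unop b).fst • (op (unop b').fst • x.2 + β x.1 (unop b').snd)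
          + β (op (unop b').fst • x.1) (unop b).snd)
    rw [hβ.addr, hβ.bal, hβ.smul, op_mul, mul_smul, mul_smul, smul_add]
    congr 1
    abel
  smul_zero b := by
    change (op (unop b).fst • (0 : P), op (unop b).fst • (0 : Z) + β 0 (unop b).snd) = 0
    rw [hβ.zerol, smul_zero, smul_zero, add_zero]
    rfl
  smul_add b x y := by
    change (op (unop b).fst • (x.1 + y.1), op (unop b).fst • (x.2 + y.2)
        + β (x.1 + y.1) (unop b).snd) =
      (op (unop b).fst • x.1 + op (unop b).fst • y.1,
        (op (unop b).fst • x.2 + β x.1 (unop b).snd) +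
          (op (unop b).fst • y.2 + β y.1 (unop b).snd))
    rw [hβ.addl, smul_add, smul_add]
    congr 1
    abel
  add_smul b b' x := by
    change ((op (unop b).fst + op (unop b').fst) • x.1, (op (unop b).fst + op (unop b').fst) • x.2
        + β x.1 ((unop b).snd + (unop b').snd)) =
      (op (unop b).fst • x.1 + op (unop b').fst • x.1,
        (op (unop b).fst • x.2 + β x.1 (unop b).snd) +
          (op (unop b').fst • x.2 + β x.1 (unop b').snd))
    rw [hβ.addr, add_smul, add_smul]
    congr 1
    abel
  zero_smul x := by
    change (op (0 : C) • x.1, op (0 : C) • x.2 + β x.1 0) = 0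
    rw [hβ.zeror, op_zero, zero_smul, zero_smul, add_zero]
    rfl

variable [Module (TrivSqZeroExt C E)ᵐᵒᵖ P] [Module (TrivSqZeroExt C E)ᵐᵒᵖ Z]
  {P0 : Type} [AddCommGroup P0] [Module (TrivSqZeroExt C E)ᵐᵒᵖ P0]

theorem bal_to_ker
    (hPB : ∀ (b : (TrivSqZeroExt C E)ᵐᵒᵖ) (p : P), b • p = op (unop b).fst • p)
    (hZB : ∀ (b : (TrivSqZeroExt C E)ᵐᵒᵖ) (z : Z), b • z = op (unop b).fst • z)
    (hP0 : Module.Projective (TrivSqZeroExt C E)ᵐᵒᵖ P0)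
    (d0 : P0 →ₗ[(TrivSqZeroExt C E)ᵐᵒᵖ] P) (hd0 : Function.Surjective d0)
    (β : P → E → Z) (hβ : IsBal (C := C) β) (hn : ∃ p e, β p e ≠ 0) :
    ∃ h : LinearMap.ker d0 →ₗ[(TrivSqZeroExt C E)ᵐᵒᵖ] Z, h ≠ 0 := by
  have main : ∃ l : P0 → P × Z, (∀ x y, l (x + y) = l x + l y) ∧
      (∀ (b : (TrivSqZeroExt C E)ᵐᵒᵖ) x, l (b • x) =
        (op (unop b).fst • (l x).1, op (unop b).fst • (l x).2 + β (l x).1 (unop b).snd)) ∧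
      ∀ x, (l x).1 = d0 x := by
    letI := balMod β hβ
    let π : (P × Z) →ₗ[(TrivSqZeroExt C E)ᵐᵒᵖ] P :=
      { toFun := fun x => x.1
        map_add' := fun x y => rfl
        map_smul' := fun b x => (hPB b x.1).symm }
    obtain ⟨l, hl⟩ := Module.projective_lifting_property π d0 (fun p => ⟨(p, 0), rfl⟩)
    exact ⟨l, fun x y => l.map_add x y, fun b x => l.map_smul b x, LinearMap.congr_fun hl⟩
  obtain ⟨l, l1, l2, l3⟩ := main
  have hk : ∀ x : LinearMap.ker d0, (l x).1 = 0 := fun x => by rw [l3]; exact x.2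
  refine ⟨{ toFun := fun x => (l x).2, map_add' := ?_, map_smul' := ?_ }, fun h0 => ?_⟩
  · intro x y
    rw [Submodule.coe_add, l1]
    rfl
  · intro b x
    rw [Submodule.coe_smul, l2, RingHom.id_apply, hZB, hk, hβ.zerol, add_zero]
  · obtain ⟨p, e, hpe⟩ := hn
    obtain ⟨x, rfl⟩ := hd0 p
    apply hpe
    have hx : d0 ((op (inr e : TrivSqZeroExt C E)) • x) = 0 := by
      rw [map_smul, hPB, unop_op, fst_inr, op_zero, zero_smul]
    have := LinearMap.congr_fun h0 ⟨_, hx⟩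
    change (l ((op (inr e : TrivSqZeroExt C E)) • x)).2 = 0 at this
    rw [l2] at this
    simpa [l3] using this

theorem exists_section
    (hPB : ∀ (b : (TrivSqZeroExt C E)ᵐᵒᵖ) (p : P), b • p = op (unop b).fst • p)
    (hP : Module.Projective Cᵐᵒᵖ P)
    (d0 : P0 →ₗ[(TrivSqZeroExt C E)ᵐᵒᵖ] P) (hd0 : Function.Surjective d0) :
    ∃ s : P →+ P0, (∀ p, d0 (s p) = p) ∧
      ∀ (c : C) p, s (op c • p) = op (inl c : TrivSqZeroExt C E) • s p := by
  letI : Module Cᵐᵒᵖ P0 := Module.compHom P0 (RingHom.op (tszeInl C E))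
  have hsm : ∀ (c : Cᵐᵒᵖ) (x : P0), c • x = op (inl (unop c) : TrivSqZeroExt C E) • x :=
    fun c x => rfl
  let d : P0 →ₗ[Cᵐᵒᵖ] P :=
    { toFun := d0
      map_add' := d0.map_add
      map_smul' := fun c x => by
        rw [hsm, map_smul, hPB]; rfl }
  obtain ⟨s, hs⟩ := Module.projective_lifting_property d LinearMap.id hd0
  exact ⟨s.toAddMonoidHom, LinearMap.congr_fun hs, fun c p => s.map_smul (op c) p⟩

theorem ker_to_bal
    (hPB : ∀ (b : (TrivSqZeroExt C E)ᵐᵒᵖ) (p : P), b • p = op (unop b).fst • p)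
    (hZB : ∀ (b : (TrivSqZeroExt C E)ᵐᵒᵖ) (z : Z), b • z = op (unop b).fst • z)
    (hP : Module.Projective Cᵐᵒᵖ P)
    (d0 : P0 →ₗ[(TrivSqZeroExt C E)ᵐᵒᵖ] P) (hd0 : Function.Surjective d0)
    (hs : ∀ N : Submodule (TrivSqZeroExt C E)ᵐᵒᵖ P0, N ⊔ LinearMap.ker d0 = ⊤ → N = ⊤)
    (h : LinearMap.ker d0 →ₗ[(TrivSqZeroExt C E)ᵐᵒᵖ] Z) (hh : h ≠ 0) :
    ∃ β : P → E → Z, IsBal (C := C) β ∧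
      ∃ p e, β p e ≠ 0 ∧ ∃ (x : P0) (hx : op (inr e : TrivSqZeroExt C E) • x ∈ LinearMap.ker d0),
        β p e = h ⟨_, hx⟩ := by
  obtain ⟨s, s1, s2⟩ := exists_section hPB hP d0 hd0
  have hx : ∀ (e : E) (x : P0), op (inr e : TrivSqZeroExt C E) • x ∈ LinearMap.ker d0 := by
    intro e x
    rw [LinearMap.mem_ker, map_smul, hPB, unop_op, fst_inr, op_zero, zero_smul]
  let β : P → E → Z := fun p e => h ⟨_, hx e (s p)⟩
  have hβ : ∀ p e, β p e = h ⟨_, hx e (s p)⟩ := fun p e => rfl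
  refine ⟨β, ⟨?_, ?_, ?_, ?_⟩, ?_⟩
  · intro p p' e
    rw [hβ, hβ, hβ, ← map_add]
    congr 1
    apply Subtype.ext
    change _ • s (p + p') = _ • s p + _ • s p'
    rw [map_add, smul_add]
  · intro p e e'
    rw [hβ, hβ, hβ, ← map_add]
    congr 1
    apply Subtype.ext
    change _ • s p = _ • s p + _ • s p
    rw [inr_add, MulOpposite.op_add, add_smul]
  · intro c p e
    rw [hβ, hβ]
    congr 1
    apply Subtype.ext
    change _ • s (op c • p) = _ • s p
    rw [s2, ← mul_smul, ← op_mul, inl_mul_inr]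
  · intro c p e
    have h1 := hZB (op (inl c)) (h ⟨_, hx e (s p)⟩)
    rw [unop_op, fst_inl] at h1
    rw [hβ, hβ, ← h1, ← LinearMap.map_smul h]
    congr 1
    apply Subtype.ext
    change _ • s p = op (inl c : TrivSqZeroExt C E) • op (inr e : TrivSqZeroExt C E) • s p
    rw [← mul_smul, ← op_mul, inr_mul_inl]
  · by_contra hcon
    have hz : ∀ p e, β p e = 0 := by
      intro p e
      by_contra h0
      exact hcon ⟨p, e, h0, s p, hx e (s p), rfl⟩
    apply hh
    have hr : ∀ x, x - s (d0 x) ∈ LinearMap.ker d0 := fun x => by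
      rw [LinearMap.mem_ker, map_sub, s1, sub_self]
    let N : Submodule (TrivSqZeroExt C E)ᵐᵒᵖ P0 :=
      { carrier := {x | h ⟨_, hr x⟩ = 0}
        add_mem' := fun {x y} hx hy => by
          change h _ = 0 at hx hy ⊢
          rw [← add_zero (0 : Z)]
          nth_rw 1 [← hx]
          rw [← hy, ← map_add]
          congr 1
          apply Subtype.ext
          change x + y - s (d0 (x + y)) = (x - s (d0 x)) + (y - s (d0 y))
          rw [map_add, map_add]
          abel
        zero_mem' := by
          change h _ = 0
          rw [← map_zero h]
          congr 1
          apply Subtype.ext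
          change (0 : P0) - s (d0 0) = 0
          rw [map_zero, map_zero, sub_zero]
        smul_mem' := fun b x hx' => by
          change h _ = 0 at hx' ⊢
          have h1 : h ⟨_, hr (b • x)⟩ = b • h ⟨_, hr x⟩ + β (d0 x) (unop b).snd := by
            rw [hβ, ← LinearMap.map_smul h, ← map_add]
            congr 1
            apply Subtype.ext
            change b • x - s (d0 (b • x)) = b • (x - s (d0 x)) + op (inr (unop b).snd) • s (d0 x)
            have h2 : b • s (d0 x) = op (inl (unop b).fst : TrivSqZeroExt C E) • s (d0 x)
                + op (inr (unop b).snd : TrivSqZeroExt C E) • s (d0 x) := by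
              rw [← add_smul, ← MulOpposite.op_add, inl_fst_add_inr_snd_eq, op_unop]
            rw [map_smul, hPB, s2, smul_sub, h2]
            abel
          rw [h1, hx', hz, smul_zero, add_zero] }
    have hN : N = ⊤ := by
      apply hs
      rw [eq_top_iff]
      intro x _
      rw [Submodule.mem_sup]
      refine ⟨s (d0 x), ?_, x - s (d0 x), hr x, by abel⟩
      change h _ = 0
      rw [← map_zero h]
      congr 1
      apply Subtype.ext
      change s (d0 x) - s (d0 (s (d0 x))) = 0
      rw [s1, sub_self]
    refine LinearMap.ext fun y => ?_
    have hy : (y : P0) ∈ N := by rw [hN]; trivial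
    change h _ = 0 at hy
    change h y = 0
    rw [← hy]
    congr 1
    apply Subtype.ext
    change (y : P0) = y - s (d0 y)
    rw [show d0 (y : P0) = 0 from y.2, map_zero, sub_zero]

/-- every map from the projective cover to a `C`-module kills the kernel. -/
theorem kills_ker
    (hPB : ∀ (b : (TrivSqZeroExt C E)ᵐᵒᵖ) (p : P), b • p = op (unop b).fst • p)
    (hZB : ∀ (b : (TrivSqZeroExt C E)ᵐᵒᵖ) (z : Z), b • z = op (unop b).fst • z)
    (hP : Module.Projective Cᵐᵒᵖ P)
    (d0 : P0 →ₗ[(TrivSqZeroExt C E)ᵐᵒᵖ] P) (hd0 : Function.Surjective d0)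
    (hs : ∀ N : Submodule (TrivSqZeroExt C E)ᵐᵒᵖ P0, N ⊔ LinearMap.ker d0 = ⊤ → N = ⊤)
    (f : P0 →ₗ[(TrivSqZeroExt C E)ᵐᵒᵖ] Z) (y : P0) (hy : d0 y = 0) : f y = 0 := by
  by_contra hne
  obtain ⟨β, -, p, e, hpe, x, hx, he⟩ := ker_to_bal hPB hZB hP d0 hd0 hs
    (f.comp (LinearMap.ker d0).subtype) (fun h0 => hne (LinearMap.congr_fun h0 ⟨y, hy⟩))
  apply hpe
  rw [he]
  change f (op (inr e : TrivSqZeroExt C E) • x) = 0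
  rw [map_smul, hZB, unop_op, fst_inr, op_zero, zero_smul]

end BSide


set_option linter.style.haveILetI false

section TauStep

variable {k : Type} [Field k] {A : Type} [Ring A] [Algebra k A]

theorem tau_hom_zero {M T P1 : Mdl Aᵐᵒᵖ}
    (hP1 : Module.Projective Aᵐᵒᵖ P1) [Module.Finite Aᵐᵒᵖ P1]
    (Tr : Mdl A) (q : (P1 →ₗ[Aᵐᵒᵖ] A) →ₗ[A] Tr) (hq : Function.Surjective q)
    (hT : IskDual k A T Tr) (hu : ∀ u : P1 →ₗ[Aᵐᵒᵖ] M, u = 0) (f : M →ₗ[Aᵐᵒᵖ] T) : f = 0 := by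
  obtain ⟨φ, h1, h2, h3, h4, h5, h6⟩ := hT
  obtain ⟨n, x, g, hx⟩ := exists_dual_basis_op (C := A) P1 hP1
  refine LinearMap.ext fun m => ?_
  apply h5
  intro t
  obtain ⟨w, rfl⟩ := hq t
  have hw : w = ∑ i, w (x i) • g i := by
    refine LinearMap.ext fun y => ?_
    conv_lhs => rw [hx y]
    rw [map_sum, LinearMap.sum_apply]
    refine Finset.sum_congr rfl fun i _ => ?_
    rw [map_smul]
    rfl
  let ψ : Tr →+ k := AddMonoidHom.mk' (fun t => φ (f m) t) (fun t t' => h2 _ _ _)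
  have z : ∀ t, φ 0 t = 0 := fun t => by
    have := h1 0 0 t
    simpa using this
  change ψ (q w) = 0
  rw [hw, map_sum, map_sum]
  refine Finset.sum_eq_zero fun i _ => ?_
  rw [map_smul]
  change φ (f m) _ = 0
  rw [← h4, ← map_smul]
  have h0 : op (w (x i)) • m = 0 := LinearMap.congr_fun (hu (dotp m w)) (x i)
  rw [h0, map_zero, z]

theorem exists_tr {P1 P0 : Mdl Aᵐᵒᵖ} (d1 : P1 →ₗ[Aᵐᵒᵖ] P0) :
    ∃ (Tr : Mdl A) (q : (P1 →ₗ[Aᵐᵒᵖ] A) →ₗ[A] Tr),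
      Function.Surjective q ∧
      (∀ g : P1 →ₗ[Aᵐᵒᵖ] A, q g = 0 ↔ ∃ f : P0 →ₗ[Aᵐᵒᵖ] A, g = f.comp d1) := by
  let S : Submodule A (P1 →ₗ[Aᵐᵒᵖ] A) :=
    { carrier := {g | ∃ f : P0 →ₗ[Aᵐᵒᵖ] A, g = f.comp d1}
      add_mem' := by
        rintro _ _ ⟨f, rfl⟩ ⟨f', rfl⟩
        exact ⟨f + f', rfl⟩
      zero_mem' := ⟨0, rfl⟩
      smul_mem' := by
        rintro a _ ⟨f, rfl⟩
        exact ⟨a • f, rfl⟩ }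
  refine ⟨ModuleCat.of A ((P1 →ₗ[Aᵐᵒᵖ] A) ⧸ S), S.mkQ, S.mkQ_surjective, fun g => ?_⟩
  exact Submodule.Quotient.mk_eq_zero S

theorem exists_kdual (Tr : Mdl A) : letI := kMod k A Tr
    letI := kTower k A Tr
    IskDual k A (ModuleCat.of Aᵐᵒᵖ (Tr →ₗ[k] k)) Tr := by
  letI := kMod k A Tr
  haveI := kTower k A Tr
  refine ⟨fun (n : Tr →ₗ[k] k) m => n m, fun n n' m => rfl, fun n m m' => n.map_add m m',
    fun c n m => n.map_smul c m, fun a n m => rfl, fun n h => LinearMap.ext h, fun m h => ?_⟩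
  by_contra hm
  obtain ⟨f, hf, -⟩ := exists_functional (⊥ : Submodule k Tr) m (by simpa using hm)
  exact hf (h f)

theorem tau_exists {M P1 P0 : Mdl Aᵐᵒᵖ} (d1 : P1 →ₗ[Aᵐᵒᵖ] P0) (d0 : P0 →ₗ[Aᵐᵒᵖ] M)
    (hmin : IsMinPres Aᵐᵒᵖ d1 d0) [Module.Finite Aᵐᵒᵖ P1]
    (hkill : ∀ (f : P0 →ₗ[Aᵐᵒᵖ] M) x, f (d1 x) = 0)
    (u : P1 →ₗ[Aᵐᵒᵖ] M) (hu : u ≠ 0) :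
    ∃ T, IsTau k A M T ∧ ∃ f : M →ₗ[Aᵐᵒᵖ] T, f ≠ 0 := by
  obtain ⟨Tr, q, hq, hqk⟩ := exists_tr d1
  letI := kMod k A Tr
  haveI := kTower k A Tr
  letI := kMod k Aᵐᵒᵖ M
  haveI := kTower k Aᵐᵒᵖ M
  refine ⟨ModuleCat.of Aᵐᵒᵖ (Tr →ₗ[k] k), ⟨P1, P0, d1, d0, hmin, Tr, q, hq, hqk,
    exists_kdual Tr⟩, ?_⟩
  have hx0 : ∃ x0, u x0 ≠ 0 := by
    by_contra hcon
    push Not at hcon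
    exact hu (LinearMap.ext hcon)
  obtain ⟨x0, hx0⟩ := hx0
  obtain ⟨ξ, hξ, -⟩ := exists_functional (⊥ : Submodule k M) (u x0) (by simpa using hx0)
  choose s hs using hq
  have key : ∀ m g, ξ (op (s (q g) x0) • m) = ξ (op (g x0) • m) := by
    intro m g
    obtain ⟨f, hf⟩ := (hqk (s (q g) - g)).1 (by rw [map_sub, hs, sub_self])
    rw [← sub_eq_zero, ← map_sub, ← sub_smul, ← MulOpposite.op_sub, ← LinearMap.sub_apply, hf]
    have := hkill (dotp m f) x0
    rw [dotp_apply] at this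
    rw [LinearMap.comp_apply, this, map_zero]
  have hs' : ∀ t, ∃ g, q g = t := fun t => ⟨s t, hs t⟩
  have hk : ∀ (c : k) t, c • t = algebraMap k A c • (t : Tr) := fun c t => rfl
  have hkM : ∀ (c : k) t, c • t = op (algebraMap k A c) • (t : M) := fun c t => rfl
  let F : M →ₗ[Aᵐᵒᵖ] (Tr →ₗ[k] k) :=
    { toFun := fun m =>
        { toFun := fun t => ξ (op (s t x0) • m)
          map_add' := fun t t' => by
            obtain ⟨g, rfl⟩ := hs' t
            obtain ⟨g', rfl⟩ := hs' t'
            rw [← map_add, key, key, key, LinearMap.add_apply, MulOpposite.op_add, add_smul,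
              map_add]
          map_smul' := fun c t => by
            obtain ⟨g, rfl⟩ := hs' t
            rw [hk, ← map_smul, key, key, RingHom.id_apply, ← LinearMap.map_smul ξ, hkM,
              ← mul_smul, ← op_mul, LinearMap.smul_apply, smul_eq_mul, Algebra.commutes] }
      map_add' := fun m m' => LinearMap.ext fun t => by
        change ξ _ = ξ _ + ξ _
        rw [smul_add, map_add]
      map_smul' := fun a m => LinearMap.ext fun t => by
        obtain ⟨g, rfl⟩ := hs' t
        change ξ (op (s (q g) x0) • a • m) = ξ (op (s (unop a • q g) x0) • m)
        rw [← map_smul, key, key, ← mul_smul]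
        rfl }
  refine ⟨F, fun h0 => hξ ?_⟩
  have hF : ∀ (m : M) (g : P1 →ₗ[Aᵐᵒᵖ] A), ξ (op (g x0) • m) = 0 := fun m g => by
    rw [← key]
    exact LinearMap.congr_fun (LinearMap.congr_fun h0 m) (q g)
  obtain ⟨n, x, g, hx⟩ := exists_dual_basis_op (C := A) P1 hmin.2.1
  rw [hx x0, map_sum, map_sum]
  refine Finset.sum_eq_zero fun i _ => ?_
  rw [map_smul, hF]

end TauStep


set_option linter.style.haveILetI false

section Final

open TrivSqZeroExt

variable {k : Type} [Field k] {C : Type} [Ring C] [Algebra k C] [FiniteDimensional k C]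
  {E : Type} [AddCommGroup E] [Module C E] [Module Cᵐᵒᵖ E] [SMulCommClass C Cᵐᵒᵖ E]
  [Module k E] [IsScalarTower k C E] [IsScalarTower k Cᵐᵒᵖ E]

theorem finite_tsze [Module.Finite k E] : Module.Finite k (TrivSqZeroExt C E)ᵐᵒᵖ := by
  haveI : Module.Finite k (TrivSqZeroExt C E) := inferInstanceAs (Module.Finite k (C × E))
  exact Module.Finite.equiv (MulOpposite.opLinearEquiv k)

theorem finite_of_compat {M : Type} [AddCommGroup M] [Module Cᵐᵒᵖ M]
    [Module (TrivSqZeroExt C E)ᵐᵒᵖ M]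
    (hMB : ∀ (b : (TrivSqZeroExt C E)ᵐᵒᵖ) (p : M), b • p = op (unop b).fst • p)
    [Module.Finite Cᵐᵒᵖ M] : Module.Finite (TrivSqZeroExt C E)ᵐᵒᵖ M := by
  obtain ⟨S, hS⟩ := (Module.finite_def (R := Cᵐᵒᵖ) (M := M)).1 inferInstance
  refine (Module.finite_def (R := (TrivSqZeroExt C E)ᵐᵒᵖ) (M := M)).2 ⟨S, ?_⟩
  rw [eq_top_iff]
  intro x _
  have hx : x ∈ Submodule.span Cᵐᵒᵖ (S : Set M) := by rw [hS]; trivial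
  induction hx using Submodule.span_induction with
  | mem x h => exact Submodule.subset_span h
  | zero => exact Submodule.zero_mem _
  | add x y _ _ h1 h2 => exact Submodule.add_mem _ (h1 trivial) (h2 trivial)
  | smul c x _ h =>
    have := hMB (op (inl (unop c))) x
    rw [unop_op, fst_inl, op_unop] at this
    rw [← this]
    exact Submodule.smul_mem _ _ (h trivial)

theorem rigid_iff [Module.Finite k E] (M : Mdl (TrivSqZeroExt C E)ᵐᵒᵖ) [Module Cᵐᵒᵖ M]
    (hMB : ∀ (b : (TrivSqZeroExt C E)ᵐᵒᵖ) (p : M), b • p = op (unop b).fst • p)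
    [Module.Finite Cᵐᵒᵖ M] (hM : Module.Projective Cᵐᵒᵖ M)
    (W Pbar : Mdl Cᵐᵒᵖ) (g : Pbar →ₗ[Cᵐᵒᵖ] W) (hg : IsProjCover Cᵐᵒᵖ g)
    (hbal : ∀ (Z : Type) [AddCommGroup Z] [Module Cᵐᵒᵖ Z],
      (∃ h : W →ₗ[Cᵐᵒᵖ] Z, h ≠ 0) ↔
        ∃ β : M → E → Z, IsBal (C := C) β ∧ ∃ p e, β p e ≠ 0) :
    TauRigid k (TrivSqZeroExt C E) M ↔ ∀ f : Pbar →ₗ[Cᵐᵒᵖ] M, f = 0 := by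
  haveI hfin : Module.Finite k (TrivSqZeroExt C E)ᵐᵒᵖ := finite_tsze
  haveI : IsArtinianRing (TrivSqZeroExt C E)ᵐᵒᵖ := IsArtinianRing.of_finite k _
  haveI : IsNoetherianRing (TrivSqZeroExt C E)ᵐᵒᵖ := IsNoetherianRing.of_finite k _
  haveI : Module.Finite (TrivSqZeroExt C E)ᵐᵒᵖ M := finite_of_compat hMB
  constructor
  · intro hτ f
    by_contra hf
    obtain ⟨h, hh⟩ := cover_to_quot g hg.2.1 hg.2.2 f hf
    obtain ⟨β, hβ, hn⟩ := (hbal _).1 ⟨h, hh⟩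
    obtain ⟨P0, d0, hP0, hd0, hs0⟩ := exists_projCover M
    haveI : Module.Finite (TrivSqZeroExt C E)ᵐᵒᵖ P0 := finite_of_cover d0 hd0 hs0
    letI : Module (TrivSqZeroExt C E)ᵐᵒᵖ (M ⧸ (LinearMap.ker g).map f) :=
      Module.compHom _ (RingHom.op (tszeFst C E))
    have hZB : ∀ (b : (TrivSqZeroExt C E)ᵐᵒᵖ) (z : M ⧸ (LinearMap.ker g).map f),
      b • z = op (unop b).fst • z := fun b z => rfl
    obtain ⟨h', hh'⟩ := bal_to_ker hMB hZB hP0 d0 hd0 β hβ hn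
    obtain ⟨P1, c1, hP1, hc1, hs1⟩ :=
      exists_projCover (ModuleCat.of (TrivSqZeroExt C E)ᵐᵒᵖ (LinearMap.ker d0))
    haveI : Module.Finite (TrivSqZeroExt C E)ᵐᵒᵖ P1 := finite_of_cover c1 hc1 hs1
    let π : M →ₗ[(TrivSqZeroExt C E)ᵐᵒᵖ] (M ⧸ (LinearMap.ker g).map f) :=
      { toFun := ((LinearMap.ker g).map f).mkQ
        map_add' := fun x y => map_add _ x y
        map_smul' := fun b x => by
          rw [hMB, map_smul]; rfl }
    obtain ⟨u, hu⟩ := quot_to_cover hP1 c1 hc1 π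
      ((LinearMap.ker g).map f).mkQ_surjective h' hh'
    let d1 : P1 →ₗ[(TrivSqZeroExt C E)ᵐᵒᵖ] P0 := (LinearMap.ker d0).subtype.comp c1
    have hmin : IsMinPres (TrivSqZeroExt C E)ᵐᵒᵖ d1 d0 := by
      refine ⟨⟨hP0, hd0, hs0⟩, hP1, ?_, ?_⟩
      · ext y
        constructor
        · rintro ⟨x, rfl⟩
          exact (c1 x).2
        · intro hy
          obtain ⟨x, hx⟩ := hc1 ⟨y, hy⟩
          exact ⟨x, congrArg Subtype.val hx⟩
      · intro N hN
        apply hs1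
        rw [← hN]
        congr 1
        ext x
        rw [LinearMap.mem_ker, LinearMap.mem_ker]
        exact ⟨fun h => congrArg Subtype.val h, fun h => Subtype.ext h⟩
    obtain ⟨T, hT, F, hF⟩ := tau_exists (k := k) d1 d0 hmin
      (fun f x => kills_ker hMB hMB hM d0 hd0 hs0 f (d1 x) (c1 x).2) u hu
    exact hF (hτ T hT F)
  · intro hzero T hT F
    obtain ⟨P1, P0, d1, d0, ⟨⟨hP0, hd0, hs0⟩, hP1, hr, hs1⟩, Tr, q, hq, hqk, hT⟩ := hT
    haveI : Module.Finite (TrivSqZeroExt C E)ᵐᵒᵖ P0 := finite_of_cover d0 hd0 hs0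
    have hc : ∀ x, d1 x ∈ LinearMap.ker d0 := fun x => hr ▸ LinearMap.mem_range_self d1 x
    let c1 : P1 →ₗ[(TrivSqZeroExt C E)ᵐᵒᵖ] LinearMap.ker d0 := d1.codRestrict _ hc
    have hc1 : Function.Surjective c1 := by
      rintro ⟨y, hy⟩
      have hy' : y ∈ LinearMap.range d1 := hr ▸ hy
      obtain ⟨x, hx⟩ := hy'
      exact ⟨x, Subtype.ext hx⟩
    have hsc : ∀ N : Submodule (TrivSqZeroExt C E)ᵐᵒᵖ P1, N ⊔ LinearMap.ker c1 = ⊤ → N = ⊤ := by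
      intro N hN
      apply hs1
      rw [← hN, LinearMap.ker_codRestrict]
    haveI : Module.Finite (TrivSqZeroExt C E)ᵐᵒᵖ P1 := finite_of_cover c1 hc1 hsc
    refine tau_hom_zero hP1 Tr q hq hT (fun u => ?_) F
    by_contra hu
    obtain ⟨h, hh⟩ := cover_to_quot c1 hc1 hsc u hu
    letI : Module Cᵐᵒᵖ (M ⧸ (LinearMap.ker c1).map u) :=
      Module.compHom _ (RingHom.op (tszeInl C E))
    have hsm : ∀ (c : Cᵐᵒᵖ) (z : M ⧸ (LinearMap.ker c1).map u),
      c • z = op (inl (unop c) : TrivSqZeroExt C E) • z := fun c z => rfl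
    have hMC : ∀ (c : Cᵐᵒᵖ) (m : M), op (inl (unop c) : TrivSqZeroExt C E) • m = c • m :=
      fun c m => hMB _ _
    have hZB : ∀ (b : (TrivSqZeroExt C E)ᵐᵒᵖ) (z : M ⧸ (LinearMap.ker c1).map u),
        b • z = op (unop b).fst • z := by
      intro b z
      obtain ⟨m, rfl⟩ := ((LinearMap.ker c1).map u).mkQ_surjective z
      rw [hsm, ← map_smul, ← map_smul, hMC, hMB]
    obtain ⟨β, hβ, p, e, hpe, -⟩ := ker_to_bal hMB hZB hM d0 hd0 hs0 h hh
    obtain ⟨h', hh'⟩ := (hbal _).2 ⟨β, hβ, p, e, hpe⟩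
    let π : M →ₗ[Cᵐᵒᵖ] (M ⧸ (LinearMap.ker c1).map u) :=
      { toFun := ((LinearMap.ker c1).map u).mkQ
        map_add' := fun x y => map_add _ x y
        map_smul' := fun c x => by
          rw [RingHom.id_apply, hsm, ← map_smul, hMC] }
    obtain ⟨v, hv⟩ := quot_to_cover hg.1 g hg.2.1 π
      ((LinearMap.ker c1).map u).mkQ_surjective h' hh'
    exact hv (hzero v)

theorem relExt_data (hgl : GlDimLE2 Cᵐᵒᵖ) (hE : IsRelExt k C E)
    (P : Mdl Cᵐᵒᵖ) [Module.Finite Cᵐᵒᵖ P] (hP : Module.Projective Cᵐᵒᵖ P)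
    (W : Mdl Cᵐᵒᵖ) (hW : IsTauInvCosyz k C P W) :
    Module.Finite k E ∧ ∀ (Z : Type) [AddCommGroup Z] [Module Cᵐᵒᵖ Z],
      (∃ h : W →ₗ[Cᵐᵒᵖ] Z, h ≠ 0) ↔
        ∃ β : P → E → Z, IsBal (C := C) β ∧ ∃ p e, β p e ≠ 0 := by
  obtain ⟨DC, φ, p1, p2, p3, p4, p5, p6, P2, P1, P0, d2, d1, d0, hP2, hP1, hP0, hd2, hd0, e1, e0,
    q, hq, hqk, hact⟩ := hE
  obtain ⟨Φ, hΦ, hΦk, hΦa⟩ := ext_iso DC φ p1 p2 p3 p4 p5 p6 P2 P1 P0 d2 d1 d0 hP2 hP1 hP0 hd2 hd0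
    e1 e0 hgl P W hW
  have hact' : ∀ c : C, ∃ f2 : P2 →ₗ[Cᵐᵒᵖ] P2, (∀ u, Φ (u.comp f2) = op c • Φ u) ∧
      ∀ g : P2 →ₗ[Cᵐᵒᵖ] C, q (g.comp f2) = op c • q g := by
    intro c
    obtain ⟨μ, f0, f1, f2, a1, a2, a3, a4, a5⟩ := hact c
    exact ⟨f2, hΦa c μ f0 f1 f2 a1 a2 a3 a4, a5⟩
  constructor
  · letI := kMod k Cᵐᵒᵖ DC
    haveI := kTower k Cᵐᵒᵖ DC
    haveI : Module.Finite k Cᵐᵒᵖ := Module.Finite.equiv (MulOpposite.opLinearEquiv k)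
    haveI : IsNoetherianRing Cᵐᵒᵖ := IsNoetherianRing.of_finite k _
    obtain ⟨hDC, -⟩ := pairing_perfect (k := k) (A := C) (N := DC) (M := C) φ p1 p2 p3 p4 p5 p6
      (Or.inr inferInstance)
    haveI : Module.Finite Cᵐᵒᵖ DC := Module.Finite.of_restrictScalars_finite k Cᵐᵒᵖ DC
    haveI : Module.Finite C E := ext2_finite DC P2 P1 P0 d2 d1 d0 hP2 hP1 hP0 hd2 hd0 e1 e0 q hq hqk
    exact Module.Finite.trans C E
  · intro Z _ _
    constructor
    · rintro ⟨h, hh⟩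
      exact hom_to_bal d2 hP Φ hΦ hΦk q hq hqk hact' h hh
    · rintro ⟨β, hβ, hn⟩
      exact bal_to_hom d2 hP Φ hΦ hΦk q hq hqk hact' β hβ hn

end Final

/-- A projective `C`-module `P` is `τ_B`-rigid iff `Hom_C(P̄, P) = 0`, where
`P̄` is a projective cover of `τ⁻¹ Ω⁻¹ P`. -/
theorem projective_tauB_rigid_iff
    (k : Type) [Field k] (C : Type) [Ring C] [Algebra k C] [FiniteDimensional k C]
    (E : Type) [AddCommGroup E] [Module C E] [Module Cᵐᵒᵖ E] [SMulCommClass C Cᵐᵒᵖ E]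
    [Module k E] [IsScalarTower k C E] [IsScalarTower k Cᵐᵒᵖ E]
    (hgl : GlDimEq2 Cᵐᵒᵖ) (hE : IsRelExt k C E)
    (P : Mdl Cᵐᵒᵖ) [Module.Finite Cᵐᵒᵖ P] (hP : Module.Projective Cᵐᵒᵖ P)
    (W Pbar : Mdl Cᵐᵒᵖ) (g : Pbar →ₗ[Cᵐᵒᵖ] W)
    (hW : IsTauInvCosyz k C P W) (hg : IsProjCover Cᵐᵒᵖ g) :
    TauRigid k (TrivSqZeroExt C E) (modB C E P) ↔ HomZero Cᵐᵒᵖ Pbar P := by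
  obtain ⟨hfin, hbal⟩ := relExt_data hgl.1 hE P hP W hW
  haveI := hfin
  letI : Module Cᵐᵒᵖ (modB C E P) := inferInstanceAs (Module Cᵐᵒᵖ P)
  haveI : Module.Finite Cᵐᵒᵖ (modB C E P) := inferInstanceAs (Module.Finite Cᵐᵒᵖ P)
  exact rigid_iff (k := k) (modB C E P) (fun b p => rfl) hP W Pbar g hg hbal
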